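/- arXiv:1111.2207 — 4 statements merged into one kernel-verified Lean document; each statement's English description precedes it below -/
import Mathlib

section
/- Let K < 0 be a real number and v ∈ ℝ. Let V₁ : [v, +∞) → (0, +∞) and w : [v, +∞) → [0, +∞) be continuous functions such that V₁(s)² − w(s) > 0 for all s ≥ v. For λ ∈ [0,1], set W_λ(s) = √(2(V₁(s)² − λ w(s))) and T(λ) = ∫_v^{+∞} ds/W_λ(s), and assume T(1) = ∫_v^{+∞} ds/√(2(V₁² − w)) < +∞, ∫_v^{+∞} w/W₁³ ds < +∞ and ∫_v^{+∞} w²/W₁⁵ ds < +∞. Define E(λ) = −K · W_λ(v)/T(λ). Then E is twice differentiable on (0,1) with dE/dλ = K [ w(v)/(W_λ(v) T(λ)) + (W_λ(v)/T(λ)²) ∫_v^{+∞} w/W_λ³ ds ], and E is concave on [0,1] (d²E/dλ² ≤ 0). -/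
open MeasureTheory Filter Set

/-- The derivative in `l` of `√(2 (a² - l b))`. -/
lemma hasDerivAt_sqrt_two_mul_sub {a b l : ℝ} (h : 0 < a ^ 2 - l * b) :
    HasDerivAt (fun l => Real.sqrt (2 * (a ^ 2 - l * b)))
      (-(b / Real.sqrt (2 * (a ^ 2 - l * b)))) l := by
  have h2 : 2 * (a ^ 2 - l * b) ≠ 0 := by positivity
  have h1 : HasDerivAt (fun l : ℝ => 2 * (a ^ 2 - l * b)) (2 * (-(1 * b))) l :=
    (((hasDerivAt_id l).mul_const b).const_sub (a ^ 2)).const_mul 2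
  refine (h1.sqrt h2).congr_deriv ?_
  ring

/-- If `g' = -b / g`, then `b ^ k / g ^ (2 k + 1)` has derivative
`(2 k + 1) b ^ (k + 1) / g ^ (2 k + 3)`. -/
lemma hasDerivAt_pow_div_odd_pow {g : ℝ → ℝ} {b l : ℝ} (hg : HasDerivAt g (-(b / g l)) l)
    (hl : g l ≠ 0) (k : ℕ) :
    HasDerivAt (fun l => b ^ k / g l ^ (2 * k + 1))
      ((2 * k + 1) * (b ^ (k + 1) / g l ^ (2 * (k + 1) + 1))) l := by
  have h := ((hg.fun_pow (2 * k + 1)).fun_inv (pow_ne_zero _ hl)).const_mul (b ^ k)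
  simp only [← div_eq_mul_inv] at h
  refine h.congr_deriv ?_
  push_cast
  field_simp
  ring

section ParametricIntegral

variable {α : Type*} [MeasurableSpace α] {μ : Measure α} {w : α → ℝ} {W : ℝ → α → ℝ}

/-- Cauchy–Schwarz for `1 / g`, `w / g ^ 3` and `w ^ 2 / g ^ 5`. -/
lemma sq_integral_div_pow_three_le {g : α → ℝ} (hg : ∀ᵐ s ∂μ, 0 < g s)
    (h0 : Integrable (fun s => (g s)⁻¹) μ) (h1 : Integrable (fun s => w s / g s ^ 3) μ)
    (h2 : Integrable (fun s => w s ^ 2 / g s ^ 5) μ) :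
    (∫ s, w s / g s ^ 3 ∂μ) ^ 2 ≤ (∫ s, (g s)⁻¹ ∂μ) * ∫ s, w s ^ 2 / g s ^ 5 ∂μ := by
  have key : ∀ t : ℝ, 0 ≤ (∫ s, (g s)⁻¹ ∂μ) * (t * t) +
      (-2 * ∫ s, w s / g s ^ 3 ∂μ) * t + ∫ s, w s ^ 2 / g s ^ 5 ∂μ := by
    intro t
    have e : ∫ s, ((g s)⁻¹ * (t * t) + w s / g s ^ 3 * (-2 * t) + w s ^ 2 / g s ^ 5) ∂μ =
        (∫ s, (g s)⁻¹ ∂μ) * (t * t) +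
          (-2 * ∫ s, w s / g s ^ 3 ∂μ) * t + ∫ s, w s ^ 2 / g s ^ 5 ∂μ := by
      rw [integral_add (by exact (h0.mul_const _).add (h1.mul_const _)) h2,
        integral_add (h0.mul_const _) (h1.mul_const _), integral_mul_const, integral_mul_const]
      ring
    rw [← e]
    refine integral_nonneg_of_ae ?_
    filter_upwards [hg] with s hs
    have e2 : (g s)⁻¹ * (t * t) + w s / g s ^ 3 * (-2 * t) + w s ^ 2 / g s ^ 5 =
        (t - w s / g s ^ 2) ^ 2 / g s := by
      field_simp
      ring
    rw [Pi.zero_apply, e2]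
    positivity
  have := discrim_le_zero key
  rw [discrim] at this
  nlinarith

/-- The quotient `b ^ k / y ^ n` is dominated by `b ^ k / x ^ n` when `0 < x ≤ y`. -/
lemma norm_pow_div_pow_le {b x y : ℝ} (hb : 0 ≤ b) (hx : 0 < x) (hxy : x ≤ y) (k n : ℕ) :
    ‖b ^ k / y ^ n‖ ≤ b ^ k / x ^ n := by
  have hy : 0 < y := hx.trans_le hxy
  rw [Real.norm_of_nonneg (by positivity)]
  gcongr

lemma integrable_pow_div_pow_of_le {g h : α → ℝ} (hw : ∀ᵐ s ∂μ, 0 ≤ w s)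
    (hh : ∀ᵐ s ∂μ, 0 < h s) (hle : ∀ᵐ s ∂μ, h s ≤ g s) (hwm : AEStronglyMeasurable w μ)
    (hgm : AEStronglyMeasurable g μ) {k n : ℕ}
    (hint : Integrable (fun s => w s ^ k / h s ^ n) μ) :
    Integrable (fun s => w s ^ k / g s ^ n) μ := by
  refine hint.mono' ((hwm.aemeasurable.pow_const k).div
    (hgm.aemeasurable.pow_const n)).aestronglyMeasurable ?_
  filter_upwards [hw, hh, hle] with s h1 h2 h3
  exact norm_pow_div_pow_le h1 h2 h3 k n

/-- Differentiation under the integral sign for `∫ w ^ k / W ^ (2 k + 1)`. -/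
lemma hasDerivAt_integral_pow_div_odd_pow (hw : ∀ᵐ s ∂μ, 0 ≤ w s)
    (h1pos : ∀ᵐ s ∂μ, 0 < W 1 s) (hle : ∀ᵐ s ∂μ, ∀ l ∈ Ioo (0 : ℝ) 1, W 1 s ≤ W l s)
    (hwm : AEStronglyMeasurable w μ)
    (hWm : ∀ l ∈ Ioo (0 : ℝ) 1, AEStronglyMeasurable (W l) μ)
    (hd : ∀ᵐ s ∂μ, ∀ l ∈ Ioo (0 : ℝ) 1, HasDerivAt (fun l => W l s) (-(w s / W l s)) l)
    {k : ℕ} (hint : Integrable (fun s => w s ^ k / W 1 s ^ (2 * k + 1)) μ)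
    (hint' : Integrable (fun s => w s ^ (k + 1) / W 1 s ^ (2 * (k + 1) + 1)) μ)
    {l : ℝ} (hl : l ∈ Ioo (0 : ℝ) 1) :
    HasDerivAt (fun l => ∫ s, w s ^ k / W l s ^ (2 * k + 1) ∂μ)
      ((2 * k + 1) * ∫ s, w s ^ (k + 1) / W l s ^ (2 * (k + 1) + 1) ∂μ) l := by
  have hm : ∀ j n : ℕ, ∀ l ∈ Ioo (0 : ℝ) 1,
      AEStronglyMeasurable (fun s => w s ^ j / W l s ^ n) μ := fun j n l hl =>
    ((hwm.aemeasurable.pow_const j).div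
      ((hWm l hl).aemeasurable.pow_const n)).aestronglyMeasurable
  have hnhds : Ioo (0 : ℝ) 1 ∈ nhds l := isOpen_Ioo.mem_nhds hl
  rw [← integral_const_mul]
  refine (hasDerivAt_integral_of_dominated_loc_of_deriv_le
    (F := fun l s => w s ^ k / W l s ^ (2 * k + 1))
    (F' := fun l s => (2 * k + 1) * (w s ^ (k + 1) / W l s ^ (2 * (k + 1) + 1)))
    hnhds (eventually_of_mem hnhds (hm _ _))
    (integrable_pow_div_pow_of_le hw h1pos (hle.mono fun s h => h l hl) hwm (hWm l hl) hint)
    ((hm _ _ l hl).const_mul _) ?_ (hint'.const_mul (2 * k + 1 : ℝ)) ?_).2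
  · filter_upwards [hw, h1pos, hle] with s a b c x hx
    rw [norm_mul, Real.norm_of_nonneg (by positivity)]
    exact mul_le_mul_of_nonneg_left (norm_pow_div_pow_le a b (c x hx) _ _) (by positivity)
  · filter_upwards [h1pos, hle, hd] with s b c d x hx
    exact hasDerivAt_pow_div_odd_pow (d x hx) (b.trans_le (c x hx)).ne' k

end ParametricIntegral

/-- (Concavity step.) With `W_λ = √(2(V₁² − λw))`,
`T(λ) = ∫_v^∞ ds/W_λ`, the function `E(λ) = −K·W_λ(v)/T(λ)` is twice differentiable
on `(0,1)` with the stated first derivative, and concave on `[0,1]`. -/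
theorem stmt14 (K : ℝ) (hK : K < 0) (v : ℝ)
    (V₁ w : ℝ → ℝ)
    (hV₁c : ContinuousOn V₁ (Ici v)) (hwc : ContinuousOn w (Ici v))
    (hV₁pos : ∀ s : ℝ, v ≤ s → 0 < V₁ s)
    (hwnonneg : ∀ s : ℝ, v ≤ s → 0 ≤ w s)
    (hpos : ∀ s : ℝ, v ≤ s → 0 < (V₁ s) ^ 2 - w s)
    (W : ℝ → ℝ → ℝ)
    (hW : ∀ (l : ℝ) (s : ℝ), W l s = Real.sqrt (2 * ((V₁ s) ^ 2 - l * w s)))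
    (T : ℝ → ℝ)
    (hT : ∀ l : ℝ, T l = ∫ s in Ioi v, (W l s)⁻¹)
    (hT1 : IntegrableOn (fun s => (W 1 s)⁻¹) (Ioi v))
    (hint1 : IntegrableOn (fun s => w s / (W 1 s) ^ 3) (Ioi v))
    (hint2 : IntegrableOn (fun s => (w s) ^ 2 / (W 1 s) ^ 5) (Ioi v))
    (E : ℝ → ℝ) (hE : ∀ l : ℝ, E l = -K * W l v / T l) :
    (∀ l ∈ Ioo (0:ℝ) 1,
        HasDerivAt E
          (K * (w v / (W l v * T l) +
            W l v / (T l) ^ 2 * ∫ s in Ioi v, w s / (W l s) ^ 3)) l) ∧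
      DifferentiableOn ℝ
        (fun l => K * (w v / (W l v * T l) +
          W l v / (T l) ^ 2 * ∫ s in Ioi v, w s / (W l s) ^ 3)) (Ioo (0:ℝ) 1) ∧
      ConcaveOn ℝ (Icc (0:ℝ) 1) E := by
  have hpos' : ∀ l ∈ Icc (0 : ℝ) 1, ∀ s, v ≤ s → 0 < (V₁ s) ^ 2 - l * w s := fun l hl s hs => by
    nlinarith [hpos s hs, hwnonneg s hs, hl.2]
  have hWpos : ∀ l ∈ Icc (0 : ℝ) 1, ∀ s, v ≤ s → 0 < W l s := fun l hl s hs => by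
    rw [hW]
    have := hpos' l hl s hs
    positivity
  have hone : (1 : ℝ) ∈ Icc (0 : ℝ) 1 := right_mem_Icc.2 zero_le_one
  have hle : ∀ l ∈ Icc (0 : ℝ) 1, ∀ s, v ≤ s → W 1 s ≤ W l s := fun l hl s hs => by
    rw [hW, hW]
    have := mul_le_mul_of_nonneg_right hl.2 (hwnonneg s hs)
    gcongr
  have hd : ∀ l ∈ Icc (0 : ℝ) 1, ∀ s, v ≤ s →
      HasDerivAt (fun l => W l s) (-(w s / W l s)) l := fun l hl s hs => by
    simp only [hW]
    exact hasDerivAt_sqrt_two_mul_sub (hpos' l hl s hs)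
  have hwm : AEStronglyMeasurable w (volume.restrict (Ioi v)) :=
    (hwc.mono Ioi_subset_Ici_self).aestronglyMeasurable measurableSet_Ioi
  have hWm : ∀ l : ℝ, AEStronglyMeasurable (W l) (volume.restrict (Ioi v)) := fun l => by
    have : ContinuousOn (W l) (Ici v) := by
      rw [funext (hW l)]
      fun_prop
    exact (this.mono Ioi_subset_Ici_self).aestronglyMeasurable measurableSet_Ioi
  have ae : ∀ {p : ℝ → Prop}, (∀ s, v ≤ s → p s) → ∀ᵐ s ∂volume.restrict (Ioi v), p s :=
    fun h => ae_restrict_of_forall_mem measurableSet_Ioi fun s hs => h s (mem_Ioi.1 hs).le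
  have hT1' : Integrable (fun s => w s ^ 0 / W 1 s ^ (2 * 0 + 1)) (volume.restrict (Ioi v)) := by
    simpa [IntegrableOn] using hT1
  have hint1' : Integrable (fun s => w s ^ 1 / W 1 s ^ (2 * 1 + 1)) (volume.restrict (Ioi v)) := by
    simpa [IntegrableOn] using hint1
  have hlow : ∀ l ∈ Icc (0 : ℝ) 1, ∀ k n : ℕ,
      Integrable (fun s => w s ^ k / W 1 s ^ n) (volume.restrict (Ioi v)) →
      Integrable (fun s => w s ^ k / W l s ^ n) (volume.restrict (Ioi v)) := fun l hl k n h =>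
    integrable_pow_div_pow_of_le (ae hwnonneg) (ae (hWpos 1 hone)) (ae (hle l hl)) hwm (hWm l) h
  have hI0 : ∀ l ∈ Icc (0 : ℝ) 1, IntegrableOn (fun s => (W l s)⁻¹) (Ioi v) := fun l hl => by
    simpa [IntegrableOn] using hlow l hl 0 _ hT1'
  have hI1 : ∀ l ∈ Icc (0 : ℝ) 1, IntegrableOn (fun s => w s / W l s ^ 3) (Ioi v) :=
    fun l hl => by simpa [IntegrableOn] using hlow l hl 1 _ hint1'
  have hTpos : ∀ l ∈ Icc (0 : ℝ) 1, 0 < T l := fun l hl => by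
    rw [hT, setIntegral_pos_iff_support_of_nonneg_ae
      (ae fun s hs => (inv_pos.2 (hWpos l hl s hs)).le) (hI0 l hl)]
    have : Ioi v ⊆ Function.support (fun s => (W l s)⁻¹) := fun s hs =>
      (inv_pos.2 (hWpos l hl s (mem_Ioi.1 hs).le)).ne'
    rw [inter_eq_self_of_subset_right this]
    simp
  have hTd : ∀ l ∈ Ioo (0 : ℝ) 1, HasDerivAt T (∫ s in Ioi v, w s / (W l s) ^ 3) l :=
    fun l hl => by
      simpa [← hT] using hasDerivAt_integral_pow_div_odd_pow (k := 0) (ae hwnonneg)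
        (ae (hWpos 1 hone)) (ae fun s hs l hl => hle l (Ioo_subset_Icc_self hl) s hs) hwm
        (fun l _ => hWm l) (ae fun s hs l hl => hd l (Ioo_subset_Icc_self hl) s hs) hT1' hint1' hl
  have hId : ∀ l ∈ Ioo (0 : ℝ) 1, HasDerivAt (fun l => ∫ s in Ioi v, w s / (W l s) ^ 3)
      (3 * ∫ s in Ioi v, w s ^ 2 / (W l s) ^ 5) l := fun l hl => by
    have := hasDerivAt_integral_pow_div_odd_pow (k := 1) (ae hwnonneg)
        (ae (hWpos 1 hone)) (ae fun s hs l hl => hle l (Ioo_subset_Icc_self hl) s hs) hwm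
        (fun l _ => hWm l) (ae fun s hs l hl => hd l (Ioo_subset_Icc_self hl) s hs) hint1' hint2 hl
    norm_num at this
    exact this
  have hCS : ∀ l ∈ Icc (0 : ℝ) 1, (∫ s in Ioi v, w s / (W l s) ^ 3) ^ 2 ≤
      T l * ∫ s in Ioi v, w s ^ 2 / (W l s) ^ 5 := fun l hl => by
    rw [hT]
    exact sq_integral_div_pow_three_le (ae (hWpos l hl)) (hI0 l hl) (hI1 l hl)
      (hlow l hl 2 5 hint2)
  have hEd : ∀ l ∈ Ioo (0 : ℝ) 1, HasDerivAt E
      (K * (w v / (W l v * T l) +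
        W l v / (T l) ^ 2 * ∫ s in Ioi v, w s / (W l s) ^ 3)) l := fun l hl => by
    have hl' := Ioo_subset_Icc_self hl
    have hWl := hWpos l hl' v le_rfl
    have hTl := hTpos l hl'
    rw [funext hE]
    refine (((hd l hl' v le_rfl).const_mul (-K)).div (hTd l hl) hTl.ne').congr_deriv ?_
    field_simp
    ring
  have hEdd : ∀ l ∈ Ioo (0 : ℝ) 1, HasDerivAt
      (fun l => K * (w v / (W l v * T l) +
        W l v / (T l) ^ 2 * ∫ s in Ioi v, w s / (W l s) ^ 3))
      (K * (W l v / T l * (w v / W l v ^ 2 - (∫ s in Ioi v, w s / (W l s) ^ 3) / T l) ^ 2 +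
        3 * W l v / T l ^ 3 * (T l * (∫ s in Ioi v, w s ^ 2 / (W l s) ^ 5) -
          (∫ s in Ioi v, w s / (W l s) ^ 3) ^ 2))) l := fun l hl => by
    have hl' := Ioo_subset_Icc_self hl
    have hWl := hWpos l hl' v le_rfl
    have hTl := hTpos l hl'
    have hWd := hd l hl' v le_rfl
    refine ((((hasDerivAt_const l (w v)).div (hWd.mul (hTd l hl)) (mul_pos hWl hTl).ne').add
      ((hWd.div ((hTd l hl).pow 2) (pow_pos hTl 2).ne').mul (hId l hl))).const_mul K).congr_deriv ?_
    simp only [Pi.mul_apply, Pi.pow_apply, Pi.div_apply]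
    field_simp
    push_cast
    ring
  refine ⟨hEd, fun l hl => (hEdd l hl).differentiableAt.differentiableWithinAt, ?_⟩
  have hTc : ContinuousOn T (Icc 0 1) := by
    rw [funext hT]
    refine continuousOn_of_dominated (bound := fun s => (W 1 s)⁻¹)
      (fun l hl => (hI0 l hl).aestronglyMeasurable) (fun l hl => ae fun s hs => ?_) hT1
      (ae fun s hs l hl => ((hd l hl s hs).continuousAt.inv₀
        (hWpos l hl s hs).ne').continuousWithinAt)
    simpa using norm_pow_div_pow_le (hwnonneg s hs) (hWpos 1 hone s hs) (hle l hl s hs) 0 1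
  have hEc : ContinuousOn E (Icc 0 1) := by
    rw [funext hE]
    exact (continuousOn_const.mul fun l hl =>
      (hd l hl v le_rfl).continuousAt.continuousWithinAt).div hTc fun l hl => (hTpos l hl).ne'
  refine concaveOn_of_hasDerivWithinAt2_nonpos (convex_Icc 0 1) hEc
    (fun l hl => (hEd l (by rwa [interior_Icc] at hl)).hasDerivWithinAt)
    (fun l hl => (hEdd l (by rwa [interior_Icc] at hl)).hasDerivWithinAt) fun l hl => ?_
  have hl' := interior_subset hl
  have hWl := hWpos l hl' v le_rfl
  have hTl := hTpos l hl'
  have hQ := sub_nonneg.2 (hCS l hl')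
  exact mul_nonpos_of_nonpos_of_nonneg hK.le (by positivity)
end

section
/- Let a ∈ ℝ, f : [a, +∞) → (0, +∞) continuous, and F(s) = ∫_a^s f(t) dt with lim_{s→+∞} F(s) = +∞. Let L > 0 and let ρ̃ : (0, 1] → (0, +∞) be continuous with lim_{t→0⁺} ρ̃(t) = L. Suppose v : (0, 1] → [a, +∞) is C², v''(t) = ρ̃(t) f(v(t)) for all t ∈ (0, 1], and lim_{t→0⁺} v(t) = +∞. Then lim_{t→0⁺} v'(t)²/F(v(t)) = 2L. -/
open MeasureTheory Filter Set

/-- One-sided estimate for l'Hôpital's rule in the form `∞ / ∞` at the right of a point, with the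
derivative of the numerator written as `r t * H' t`. -/
theorem eventually_div_lt_of_deriv_eq_mul {G H H' r : ℝ → ℝ} {x ℓ m : ℝ}
    (hG : ∀ᶠ t in nhdsWithin x (Ioi x), HasDerivAt G (r t * H' t) t)
    (hH : ∀ᶠ t in nhdsWithin x (Ioi x), HasDerivAt H (H' t) t)
    (hH' : ∀ᶠ t in nhdsWithin x (Ioi x), H' t ≤ 0)
    (hr : Tendsto r (nhdsWithin x (Ioi x)) (nhds ℓ))
    (hHtop : Tendsto H (nhdsWithin x (Ioi x)) atTop) (hm : ℓ < m) :
    ∀ᶠ t in nhdsWithin x (Ioi x), G t / H t < m := by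
  obtain ⟨k, hk, hkm⟩ := exists_between hm
  have hall := (hG.and (hH.and (hH'.and (hr.eventually_lt_const hk))))
  obtain ⟨d, hd, hsub⟩ := mem_nhdsGT_iff_exists_Ioo_subset.1 hall
  have hd : x < d := hd
  obtain ⟨c, hxc, hcd⟩ := exists_between hd
  have hder : ∀ t ∈ Ioo x d,
      HasDerivAt (fun t => G t - k * H t) (r t * H' t - k * H' t) t := fun t ht =>
    (hsub ht).1.sub ((hsub ht).2.1.const_mul k)
  have hmono : MonotoneOn (fun t => G t - k * H t) (Ioo x d) := by
    refine monotoneOn_of_deriv_nonneg (convex_Ioo x d)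
      (fun t ht => (hder t ht).continuousAt.continuousWithinAt)
      (fun t ht => ?_) (fun t ht => ?_)
    · rw [interior_Ioo] at ht
      exact (hder t ht).differentiableAt.differentiableWithinAt
    · rw [interior_Ioo] at ht
      rw [(hder t ht).deriv]
      obtain ⟨-, -, h1, h2⟩ := hsub ht
      nlinarith
  filter_upwards [Ioo_mem_nhdsGT hxc, hHtop.eventually_gt_atTop 0,
    hHtop.eventually_gt_atTop ((G c - k * H c) / (m - k))] with t ht hpos hbig
  have h1 : G t - k * H t ≤ G c - k * H c :=
    hmono ⟨ht.1, ht.2.trans hcd⟩ ⟨hxc, hcd⟩ ht.2.le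
  rw [div_lt_iff₀ (sub_pos.2 hkm)] at hbig
  rw [div_lt_iff₀ hpos]
  linarith

/-- L'Hôpital's rule in the form `∞ / ∞` at the right of a point, with the derivative of the
numerator written as `r t * H' t`. -/
theorem tendsto_div_of_deriv_eq_mul {G H H' r : ℝ → ℝ} {x ℓ : ℝ}
    (hG : ∀ᶠ t in nhdsWithin x (Ioi x), HasDerivAt G (r t * H' t) t)
    (hH : ∀ᶠ t in nhdsWithin x (Ioi x), HasDerivAt H (H' t) t)
    (hH' : ∀ᶠ t in nhdsWithin x (Ioi x), H' t ≤ 0)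
    (hr : Tendsto r (nhdsWithin x (Ioi x)) (nhds ℓ))
    (hHtop : Tendsto H (nhdsWithin x (Ioi x)) atTop) :
    Tendsto (fun t => G t / H t) (nhdsWithin x (Ioi x)) (nhds ℓ) := by
  refine tendsto_order.2 ⟨fun m hm => ?_, fun m hm =>
    eventually_div_lt_of_deriv_eq_mul hG hH hH' hr hHtop hm⟩
  have hG' : ∀ᶠ t in nhdsWithin x (Ioi x), HasDerivAt (fun t => -G t) (-r t * H' t) t := by
    filter_upwards [hG] with t ht
    simpa only [neg_mul] using ht.fun_neg
  filter_upwards [eventually_div_lt_of_deriv_eq_mul hG' hH hH' hr.neg hHtop (neg_lt_neg hm)]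
    with t ht
  rw [neg_div] at ht
  exact neg_lt_neg_iff.1 ht

/-- A function with monotone derivative on `(0, 1]` which blows up at `0` is eventually
decreasing there. -/
theorem eventually_deriv_neg_of_tendsto_atTop {v v' : ℝ → ℝ}
    (hv : ∀ t ∈ Ioc (0 : ℝ) 1, HasDerivAt v (v' t) t) (hmono : MonotoneOn v' (Ioc 0 1))
    (hblow : Tendsto v (nhdsWithin 0 (Ioi 0)) atTop) :
    ∀ᶠ t in nhdsWithin (0 : ℝ) (Ioi 0), v' t < 0 := by
  obtain ⟨c, hc, hcneg⟩ : ∃ c ∈ Ioc (0 : ℝ) 1, v' c < 0 := by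
    by_contra! hcon
    have hvmono : MonotoneOn v (Ioc 0 1) := by
      refine monotoneOn_of_deriv_nonneg (convex_Ioc 0 1)
        (fun t ht => (hv t ht).continuousAt.continuousWithinAt)
        (fun t ht => (hv t (interior_subset ht)).differentiableAt.differentiableWithinAt)
        (fun t ht => ?_)
      rw [(hv t (interior_subset ht)).deriv]
      exact hcon t (interior_subset ht)
    obtain ⟨t, ht, hlt⟩ := (Filter.Eventually.and (Ioc_mem_nhdsGT (zero_lt_one' ℝ))
      (hblow.eventually_gt_atTop (v 1))).exists
    exact absurd (hvmono ht ⟨zero_lt_one, le_rfl⟩ ht.2) (not_le.2 hlt)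
  filter_upwards [Ioc_mem_nhdsGT hc.1] with t ht
  exact (hmono ⟨ht.1, ht.2.trans hc.2⟩ hc ht.2).trans_lt hcneg

/-- (L'Hôpital step.) If `v'' = ρ̃(t) f(v)` on `(0,1]`,
`v(t) → +∞` as `t → 0⁺` and `ρ̃(t) → L`, then `v'(t)²/F(v(t)) → 2L` as `t → 0⁺`,
where `F(s) = ∫_a^s f` tends to `+∞` at `+∞`. -/
theorem stmt15 (a : ℝ) (f : ℝ → ℝ)
    (hfc : ContinuousOn f (Ici a)) (hfpos : ∀ s : ℝ, a ≤ s → 0 < f s)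
    (F : ℝ → ℝ) (hF : ∀ s, F s = ∫ t in a..s, f t)
    (hFtop : Tendsto F atTop atTop)
    (L : ℝ) (hL : 0 < L)
    (ρt : ℝ → ℝ) (hρc : ContinuousOn ρt (Ioc 0 1))
    (hρpos : ∀ t : ℝ, t ∈ Ioc (0:ℝ) 1 → 0 < ρt t)
    (hρlim : Tendsto ρt (nhdsWithin 0 (Ioi 0)) (nhds L))
    (v v' v'' : ℝ → ℝ)
    (hv : ∀ t ∈ Ioc (0:ℝ) 1, HasDerivAt v (v' t) t)
    (hv' : ∀ t ∈ Ioc (0:ℝ) 1, HasDerivAt v' (v'' t) t)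
    (hv''c : ContinuousOn v'' (Ioc 0 1))
    (hva : ∀ t ∈ Ioc (0:ℝ) 1, a ≤ v t)
    (hODE : ∀ t ∈ Ioc (0:ℝ) 1, v'' t = ρt t * f (v t))
    (hblow : Tendsto v (nhdsWithin 0 (Ioi 0)) atTop) :
    Tendsto (fun t => (v' t) ^ 2 / F (v t)) (nhdsWithin 0 (Ioi 0)) (nhds (2 * L)) := by
  have hIoc : ∀ᶠ t in nhdsWithin (0 : ℝ) (Ioi 0), t ∈ Ioc (0 : ℝ) 1 :=
    Ioc_mem_nhdsGT zero_lt_one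
  have hmono : MonotoneOn v' (Ioc 0 1) := by
    refine monotoneOn_of_deriv_nonneg (convex_Ioc 0 1)
      (fun t ht => (hv' t ht).continuousAt.continuousWithinAt)
      (fun t ht => (hv' t (interior_subset ht)).differentiableAt.differentiableWithinAt)
      (fun t ht => ?_)
    have ht := interior_subset ht
    rw [(hv' t ht).deriv, hODE t ht]
    exact (mul_pos (hρpos t ht) (hfpos _ (hva t ht))).le
  have hneg := eventually_deriv_neg_of_tendsto_atTop hv hmono hblow
  have hFderiv : ∀ s, a < s → HasDerivAt F (f s) s := by
    intro s hs
    rw [funext hF]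
    refine intervalIntegral.integral_hasDerivAt_right ?_ ?_ (hfc.continuousAt (Ici_mem_nhds hs))
    · refine ContinuousOn.intervalIntegrable (hfc.mono ?_)
      rw [uIcc_of_le hs.le]
      exact Icc_subset_Ici_self
    · exact (hfc.mono Ioi_subset_Ici_self).stronglyMeasurableAtFilter isOpen_Ioi s hs
  refine tendsto_div_of_deriv_eq_mul (H' := fun t => f (v t) * v' t) (r := fun t => 2 * ρt t)
    ?_ ?_ ?_ (hρlim.const_mul 2) (hFtop.comp hblow)
  · filter_upwards [hIoc] with t ht
    refine ((hv' t ht).fun_pow 2).congr_deriv ?_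
    rw [hODE t ht]
    push_cast
    ring
  · filter_upwards [hIoc, hblow.eventually_gt_atTop a] with t ht hat
    exact (hFderiv _ hat).comp t (hv t ht)
  · filter_upwards [hIoc, hneg] with t ht hlt
    exact mul_nonpos_of_nonneg_of_nonpos (hfpos _ (hva t ht)).le hlt.le
end

section
/- Let D ≥ 3, a > 0, f : [a, +∞) → (0, +∞) continuous with F(s) = ∫_a^s f(t) dt satisfying ∫^{+∞} ds/√F(s) < +∞, and let ρ̃ : (0, 1] → (0, +∞) be Lipschitz continuous with lim_{t→0⁺} ρ̃(t) = 1/(D−2)². For i = 1, 2, let V_i : [a, +∞) → (0, +∞) be C¹ with t_i(v) := ∫_v^{+∞} ds/V_i(s) ≤ 1 for all v ≥ a, satisfying V_i(v) V_i'(v) = ρ̃(t_i(v)) f(v) for all v ≥ a and lim_{v→+∞} V_i(v)²/F(v) = 2/(D−2)². Then there exist constants C > 0 and v₀ ≥ a such that √F(v) · |V₁(v) − V₂(v)| ≤ C for all v ≥ v₀. -/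
open MeasureTheory Filter Set

theorem hasDerivAt_integral_Ioi_of_continuousOn {g : ℝ → ℝ} {b v : ℝ}
    (hg : ContinuousOn g (Ioi b)) (hint : IntegrableOn g (Ioi b)) (hv : b < v) :
    HasDerivAt (fun x => ∫ s in Ioi x, g s) (-g v) v := by
  have hright : HasDerivAt (fun x => ∫ s in b..x, g s) (g v) v :=
    intervalIntegral.integral_hasDerivAt_right
      ((intervalIntegrable_iff_integrableOn_Ioc_of_le hv.le).2
        (hint.mono_set Ioc_subset_Ioi_self))
      (hg.stronglyMeasurableAtFilter isOpen_Ioi v hv)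
      (hg.continuousAt (Ioi_mem_nhds hv))
  refine (hright.const_sub (∫ s in Ioi b, g s)).congr_of_eventuallyEq ?_
  filter_upwards [Ioi_mem_nhds hv] with x hx
  rw [← intervalIntegral.integral_Ioi_sub_Ioi hint (le_of_lt hx)]
  ring

theorem abs_le_add_of_abs_deriv_le {W W' Φ Φ' : ℝ → ℝ} {v₀ v : ℝ} (hv : v₀ ≤ v)
    (hW : ∀ x, v₀ ≤ x → HasDerivAt W (W' x) x) (hΦ : ∀ x, v₀ ≤ x → HasDerivAt Φ (Φ' x) x)
    (hle : ∀ x, v₀ ≤ x → |W' x| ≤ Φ' x) : |W v| ≤ |W v₀| + (Φ v - Φ v₀) := by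
  have hB : ∀ x, v₀ ≤ x → HasDerivAt (fun y => |W v₀| + (Φ y - Φ v₀)) (Φ' x) x := fun x hx =>
    ((hΦ x hx).sub_const _).const_add _
  exact image_norm_le_of_norm_deriv_right_le_deriv_boundary' (f := W)
    (B := fun y => |W v₀| + (Φ y - Φ v₀)) (a := v₀) (b := v)
    (fun x hx => (hW x hx.1).continuousAt.continuousWithinAt)
    (fun x hx => (hW x hx.1).hasDerivWithinAt) (by simp)
    (fun x hx => (hB x hx.1).continuousAt.continuousWithinAt)
    (fun x hx => (hB x hx.1).hasDerivWithinAt) (fun x hx => hle x hx.1) ⟨hv, le_rfl⟩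

/-- If `|W'(v)| ≤ κ f(v) ∫_v^∞ |W| F^{-3/2}` with `F' = f` and `κ ∫_{v₀}^∞ F^{-1/2} ≤ 1/2`, then a
bound `W = O(F)` improves to boundedness of `W`. -/
theorem abs_le_two_mul_of_abs_deriv_le_tail_integral {F f W W' : ℝ → ℝ} {b v₀ κ B : ℝ}
    (hb : b < v₀) (hκ : 0 ≤ κ) (hF : ∀ v, b < v → HasDerivAt F (f v) v)
    (hFpos : ∀ v, b < v → 0 < F v) (hf : ∀ v, b < v → 0 ≤ f v)
    (hint : IntegrableOn (fun s => 1 / Real.sqrt (F s)) (Ioi b))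
    (hW : ∀ v, v₀ ≤ v → HasDerivAt W (W' v) v)
    (hW' : ∀ v, v₀ ≤ v →
      |W' v| ≤ κ * f v * ∫ s in Ioi v, |W s| * (1 / (F s * Real.sqrt (F s))))
    (hsmall : κ * ∫ s in Ioi v₀, 1 / Real.sqrt (F s) ≤ 1 / 2)
    (hB : 0 ≤ B) (hWB : ∀ v, v₀ ≤ v → |W v| ≤ B * F v) :
    ∀ v, v₀ ≤ v → |W v| ≤ 2 * |W v₀| := by
  have hFc : ContinuousOn F (Ioi b) := fun v hv => (hF v hv).continuousAt.continuousWithinAt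
  have hmono : MonotoneOn F (Ioi b) := by
    refine monotoneOn_of_deriv_nonneg (convex_Ioi b) hFc ?_ ?_
    · rw [interior_Ioi]
      exact fun v hv => (hF v hv).differentiableAt.differentiableWithinAt
    · rw [interior_Ioi]
      intro v hv
      rw [(hF v hv).deriv]
      exact hf v hv
  have hgc : ContinuousOn (fun s => 1 / Real.sqrt (F s)) (Ioi b) :=
    continuousOn_const.div hFc.sqrt fun v hv => (Real.sqrt_pos.2 (hFpos v hv)).ne'
  have hqc : ContinuousOn (fun s => 1 / (F s * Real.sqrt (F s))) (Ioi b) :=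
    continuousOn_const.div (hFc.mul hFc.sqrt) fun v hv =>
      (mul_pos (hFpos v hv) (Real.sqrt_pos.2 (hFpos v hv))).ne'
  obtain ⟨d, hbd, hdv⟩ := exists_between hb
  have hsub : ∀ {v}, d ≤ v → Ioi v ⊆ Ioi b := fun hv => Ioi_subset_Ioi (hbd.le.trans hv)
  -- `F^{-3/2} ≤ F(v)^{-1} F^{-1/2}` on `(v, ∞)`
  have hqle : ∀ v, d ≤ v → ∀ s, v < s →
      1 / (F s * Real.sqrt (F s)) ≤ (F v)⁻¹ * (1 / Real.sqrt (F s)) := by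
    intro v hv s hs
    have hbv : b < v := hbd.trans_le hv
    have h1 := hFpos s (hbv.trans hs)
    have h2 := hFpos v hbv
    have h3 : (F s)⁻¹ ≤ (F v)⁻¹ := inv_anti₀ h2 (hmono hbv (hbv.trans hs) hs.le)
    have h4 : 1 / (F s * Real.sqrt (F s)) = (F s)⁻¹ * (1 / Real.sqrt (F s)) := by
      rw [one_div, one_div, mul_inv]
    rw [h4]
    exact mul_le_mul_of_nonneg_right h3 (by positivity)
  have hq0 : ∀ s, b < s → 0 ≤ 1 / (F s * Real.sqrt (F s)) := fun s hs =>
    one_div_nonneg.2 (mul_nonneg (hFpos s hs).le (Real.sqrt_nonneg _))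
  have hqint : IntegrableOn (fun s => 1 / (F s * Real.sqrt (F s))) (Ioi d) := by
    refine Integrable.mono' ((hint.mono_set (hsub le_rfl)).const_mul (F d)⁻¹)
      ((hqc.mono (hsub le_rfl)).aestronglyMeasurable measurableSet_Ioi) ?_
    filter_upwards [ae_restrict_mem measurableSet_Ioi] with s hs
    rw [Real.norm_of_nonneg (hq0 s (hbd.trans hs))]
    exact hqle d le_rfl s hs
  set I : ℝ → ℝ := fun v => ∫ s in Ioi v, 1 / (F s * Real.sqrt (F s)) with hI
  set J : ℝ → ℝ := fun v => ∫ s in Ioi v, 1 / Real.sqrt (F s) with hJ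
  have hΨ : ∀ v, v₀ ≤ v → HasDerivAt (fun x => F x * I x - J x) (f v * I v) v := by
    intro v hv
    have hbv := hb.trans_le hv
    have h1 := hasDerivAt_integral_Ioi_of_continuousOn (hqc.mono (hsub le_rfl)) hqint
      (hdv.trans_le hv)
    have h2 := hasDerivAt_integral_Ioi_of_continuousOn hgc hint hbv
    have h3 := ((hF v hbv).mul h1).sub h2
    have h4 := hFpos v hbv
    have h5 : F v * (1 / (F v * Real.sqrt (F v))) = 1 / Real.sqrt (F v) := by field_simp
    refine h3.congr_deriv ?_
    linear_combination -h5
  have hIJ : ∀ v, v₀ ≤ v → F v * I v ≤ J v := by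
    intro v hv
    have hdv' := hdv.le.trans hv
    have h2 := hFpos v (hb.trans_le hv)
    have : I v ≤ (F v)⁻¹ * J v := by
      rw [hJ, ← integral_const_mul]
      exact setIntegral_mono_on (hqint.mono_set (Ioi_subset_Ioi hdv'))
        ((hint.mono_set (hsub hdv')).const_mul _) measurableSet_Ioi (hqle v hdv')
    calc F v * I v ≤ F v * ((F v)⁻¹ * J v) := mul_le_mul_of_nonneg_left this h2.le
      _ = J v := by field_simp
  have hI0 : ∀ v, v₀ ≤ v → 0 ≤ I v := fun v hv =>
    setIntegral_nonneg measurableSet_Ioi fun s hs => hq0 s ((hb.trans_le hv).trans hs)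
  have hJ0 : ∀ v, v₀ ≤ v → J v ≤ J v₀ := fun v hv =>
    setIntegral_mono_set (hint.mono_set (hsub hdv.le))
      (ae_restrict_of_forall_mem measurableSet_Ioi fun s _ => by positivity)
      (Ioi_subset_Ioi hv).eventuallyLE
  have step : ∀ P Q : ℝ, 0 ≤ P → 0 ≤ Q → (∀ v, v₀ ≤ v → |W v| ≤ P + Q * F v) →
      ∀ v, v₀ ≤ v → |W v| ≤ |W v₀| + P / 2 + Q / 2 * F v := by
    intro P Q hP hQ hPQ v hv
    have htail : ∀ x, v₀ ≤ x →
        ∫ s in Ioi x, |W s| * (1 / (F s * Real.sqrt (F s))) ≤ P * I x + Q * J v₀ := by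
      intro x hx
      have hdx := hdv.le.trans hx
      have hi1 := (hqint.mono_set (Ioi_subset_Ioi hdx)).const_mul P
      have hi2 := (hint.mono_set (hsub hdx)).const_mul Q
      have : ∫ s in Ioi x, |W s| * (1 / (F s * Real.sqrt (F s))) ≤
          ∫ s in Ioi x, (P * (1 / (F s * Real.sqrt (F s))) + Q * (1 / Real.sqrt (F s))) := by
        refine integral_mono_of_nonneg ?_ (hi1.add hi2) ?_
        · exact ae_restrict_of_forall_mem measurableSet_Ioi fun s hs =>
            mul_nonneg (abs_nonneg _) (hq0 s ((hb.trans_le hx).trans hs))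
        · refine ae_restrict_of_forall_mem measurableSet_Ioi fun s hs => ?_
          have hbs : b < s := (hb.trans_le hx).trans hs
          have h1 := hFpos s hbs
          have h2 := Real.sqrt_pos.2 h1
          calc |W s| * (1 / (F s * Real.sqrt (F s)))
              ≤ (P + Q * F s) * (1 / (F s * Real.sqrt (F s))) :=
                mul_le_mul_of_nonneg_right (hPQ s (hx.trans (le_of_lt hs))) (hq0 s hbs)
            _ = P * (1 / (F s * Real.sqrt (F s))) + Q * (1 / Real.sqrt (F s)) := by
                field_simp
      rw [integral_add hi1 hi2, integral_const_mul, integral_const_mul] at this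
      exact this.trans (by gcongr; exact hJ0 x hx)
    have hbnd := abs_le_add_of_abs_deriv_le (W := W) (W' := W')
      (Φ := fun x => κ * P * (F x * I x - J x) + κ * Q * J v₀ * F x)
      (Φ' := fun x => κ * P * (f x * I x) + κ * Q * J v₀ * f x) hv hW
      (fun x hx => ((hΨ x hx).const_mul _).add ((hF x (hb.trans_le hx)).const_mul _))
      (fun x hx => by
        have hfx := hf x (hb.trans_le hx)
        calc |W' x| ≤ _ := hW' x hx
          _ ≤ κ * f x * (P * I x + Q * J v₀) :=
            mul_le_mul_of_nonneg_left (htail x hx) (mul_nonneg hκ hfx)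
          _ = _ := by ring)
    have hJv₀ : 0 ≤ J v₀ := setIntegral_nonneg measurableSet_Ioi fun s _ => by positivity
    have h1 : κ * P * (F v * I v - J v) ≤ 0 :=
      mul_nonpos_of_nonneg_of_nonpos (mul_nonneg hκ hP) (by linarith [hIJ v hv])
    have h2 : 0 ≤ κ * P * (F v₀ * I v₀) :=
      mul_nonneg (mul_nonneg hκ hP) (mul_nonneg (hFpos v₀ hb).le (hI0 v₀ le_rfl))
    have h3 : P * (κ * J v₀) ≤ P * (1 / 2) := mul_le_mul_of_nonneg_left hsmall hP
    have h4 : Q * F v * (κ * J v₀) ≤ Q * F v * (1 / 2) :=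
      mul_le_mul_of_nonneg_left hsmall (mul_nonneg hQ (hFpos v (hb.trans_le hv)).le)
    have h5 : 0 ≤ κ * Q * J v₀ * F v₀ :=
      mul_nonneg (mul_nonneg (mul_nonneg hκ hQ) hJv₀) (hFpos v₀ hb).le
    linarith
  have iter : ∀ n : ℕ, ∀ v, v₀ ≤ v → |W v| ≤ 2 * |W v₀| + B * (1 / 2) ^ n * F v := by
    intro n
    induction n with
    | zero => exact fun v hv => by simpa using (hWB v hv).trans (by linarith [abs_nonneg (W v₀)])
    | succ n ih =>
      intro v hv
      refine (step _ _ (by positivity) (by positivity) ih v hv).trans (le_of_eq ?_)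
      ring
  intro v hv
  have h : Tendsto (fun n : ℕ => ((1 : ℝ) / 2) ^ n) atTop (nhds 0) :=
    tendsto_pow_atTop_nhds_zero_of_lt_one (by norm_num) (by norm_num)
  have hlim := ((h.const_mul B).mul_const (F v)).const_add (2 * |W v₀|)
  simp only [mul_zero, zero_mul, add_zero] at hlim
  exact ge_of_tendsto' hlim fun n => iter n v hv

/-- (A priori estimate.) For two solutions `V_i` of
`V V' = ρ̃(t(v)) f(v)`, `t_i(v) = ∫_v^∞ ds/V_i ≤ 1`, with
`V_i²/F → 2/(D−2)²`, one has `√F(v) |V₁(v) − V₂(v)| ≤ C` for large `v`. -/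
theorem stmt16 (D : ℕ) (hD : 3 ≤ D) (a : ℝ) (ha : 0 < a)
    (f : ℝ → ℝ) (hfc : ContinuousOn f (Ici a)) (hfpos : ∀ v : ℝ, a ≤ v → 0 < f v)
    (F : ℝ → ℝ) (hF : ∀ s, F s = ∫ t in a..s, f t)
    (hKO : ∃ b : ℝ, a < b ∧ IntegrableOn (fun s => 1 / Real.sqrt (F s)) (Ici b))
    (ρt : ℝ → ℝ) (hρpos : ∀ t : ℝ, t ∈ Ioc (0:ℝ) 1 → 0 < ρt t)
    (hρlip : ∃ Λ : NNReal, LipschitzOnWith Λ ρt (Ioc 0 1))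
    (hρlim : Tendsto ρt (nhdsWithin 0 (Ioi 0)) (nhds (1 / ((D:ℝ) - 2) ^ 2)))
    (V₁ V₁' V₂ V₂' : ℝ → ℝ)
    (hV₁pos : ∀ v : ℝ, a ≤ v → 0 < V₁ v) (hV₂pos : ∀ v : ℝ, a ≤ v → 0 < V₂ v)
    (hV₁ : ∀ v : ℝ, a ≤ v → HasDerivAt V₁ (V₁' v) v)
    (hV₂ : ∀ v : ℝ, a ≤ v → HasDerivAt V₂ (V₂' v) v)
    (hV₁'c : ContinuousOn V₁' (Ici a)) (hV₂'c : ContinuousOn V₂' (Ici a))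
    (t₁ t₂ : ℝ → ℝ)
    (ht₁ : ∀ v : ℝ, t₁ v = ∫ s in Ioi v, (V₁ s)⁻¹)
    (ht₂ : ∀ v : ℝ, t₂ v = ∫ s in Ioi v, (V₂ s)⁻¹)
    (hV₁int : IntegrableOn (fun s => (V₁ s)⁻¹) (Ici a))
    (hV₂int : IntegrableOn (fun s => (V₂ s)⁻¹) (Ici a))
    (ht₁le : ∀ v : ℝ, a ≤ v → t₁ v ≤ 1) (ht₂le : ∀ v : ℝ, a ≤ v → t₂ v ≤ 1)
    (hODE₁ : ∀ v : ℝ, a ≤ v → V₁ v * V₁' v = ρt (t₁ v) * f v)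
    (hODE₂ : ∀ v : ℝ, a ≤ v → V₂ v * V₂' v = ρt (t₂ v) * f v)
    (hlim₁ : Tendsto (fun v => (V₁ v) ^ 2 / F v) atTop (nhds (2 / ((D:ℝ) - 2) ^ 2)))
    (hlim₂ : Tendsto (fun v => (V₂ v) ^ 2 / F v) atTop (nhds (2 / ((D:ℝ) - 2) ^ 2))) :
    ∃ C : ℝ, 0 < C ∧ ∃ v₀ : ℝ, a ≤ v₀ ∧
      ∀ v : ℝ, v₀ ≤ v → Real.sqrt (F v) * |V₁ v - V₂ v| ≤ C := by
  obtain ⟨b, hab, hKOb⟩ := hKO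
  obtain ⟨Λ, hΛ⟩ := hρlip
  have hD2 : (0 : ℝ) < (D : ℝ) - 2 := by
    have : (3 : ℝ) ≤ D := by exact_mod_cast hD
    linarith
  set k : ℝ := 2 / ((D : ℝ) - 2) ^ 2 with hk
  have hkpos : 0 < k := by positivity
  set c : ℝ := Real.sqrt (k / 2) with hc
  have hcpos : 0 < c := Real.sqrt_pos.2 (by positivity)
  have hfi : ∀ v, a ≤ v → IntervalIntegrable f volume a v := fun v hv =>
    (hfc.mono (by rw [uIcc_of_le hv]; exact Icc_subset_Ici_self)).intervalIntegrable
  have hFpos : ∀ v, a < v → 0 < F v := fun v hv => by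
    rw [hF]
    exact intervalIntegral.intervalIntegral_pos_of_pos_on (hfi v hv.le)
      (fun x hx => hfpos x hx.1.le) hv
  have hFd : ∀ v, a < v → HasDerivAt F (f v) v := fun v hv => by
    rw [funext hF]
    exact intervalIntegral.integral_hasDerivAt_right (hfi v hv.le)
      ((hfc.mono Ioi_subset_Ici_self).stronglyMeasurableAtFilter isOpen_Ioi v hv)
      (hfc.continuousAt (Ici_mem_nhds hv))
  have hint : IntegrableOn (fun s => 1 / Real.sqrt (F s)) (Ioi b) :=
    hKOb.mono_set Ioi_subset_Ici_self
  have hsmall : ∀ᶠ v in atTop,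
      (Λ / c ^ 3 : ℝ) * ∫ s in Ioi v, 1 / Real.sqrt (F s) ≤ 1 / 2 := by
    have h := (tendsto_integral_Ioi_zero (μ := volume) (f := fun s => 1 / Real.sqrt (F s))
      (tendsto_id (α := ℝ) (x := atTop))).const_mul (Λ / c ^ 3 : ℝ)
    rw [mul_zero] at h
    exact h.eventually (eventually_le_nhds (by norm_num))
  have hnhds : Icc (k / 2) (2 * k) ∈ nhds k := Icc_mem_nhds (by linarith) (by linarith)
  obtain ⟨v₀, hv₀⟩ := eventually_atTop.1
    ((eventually_gt_atTop b).and (hsmall.and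
      ((hlim₁.eventually hnhds).and
      (hlim₂.eventually hnhds))))
  have hbv₀ : b < v₀ := (hv₀ v₀ le_rfl).1
  have hav : ∀ {v}, v₀ ≤ v → a < v := fun hv => hab.trans (hbv₀.trans_le hv)
  have hlow : ∀ (V : ℝ → ℝ) v, a < v → 0 < V v → k / 2 ≤ V v ^ 2 / F v →
      c * Real.sqrt (F v) ≤ V v := by
    intro V v hv hV h
    rw [hc, ← Real.sqrt_mul (by positivity)]
    exact Real.sqrt_le_iff.2 ⟨hV.le, (le_div_iff₀ (hFpos v hv)).1 h⟩
  have hlow₁ : ∀ v, v₀ ≤ v → c * Real.sqrt (F v) ≤ V₁ v := fun v hv =>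
    hlow V₁ v (hav hv) (hV₁pos v (hav hv).le) (hv₀ v hv).2.2.1.1
  have hlow₂ : ∀ v, v₀ ≤ v → c * Real.sqrt (F v) ≤ V₂ v := fun v hv =>
    hlow V₂ v (hav hv) (hV₂pos v (hav hv).le) (hv₀ v hv).2.2.2.1
  set W : ℝ → ℝ := fun v => V₁ v ^ 2 - V₂ v ^ 2 with hWdef
  have hWd : ∀ v, v₀ ≤ v → HasDerivAt W (2 * (ρt (t₁ v) - ρt (t₂ v)) * f v) v := fun v hv =>
    (((hV₁ v (hav hv).le).pow 2).sub ((hV₂ v (hav hv).le).pow 2)).congr_deriv (by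
      have h1 := hODE₁ v (hav hv).le
      have h2 := hODE₂ v (hav hv).le
      push_cast
      linear_combination 2 * h1 - 2 * h2)
  have hWfac : ∀ v, a ≤ v → |W v| = |V₁ v - V₂ v| * (V₁ v + V₂ v) := fun v hv => by
    have h1 := hV₁pos v hv
    have h2 := hV₂pos v hv
    have h3 : W v = (V₁ v - V₂ v) * (V₁ v + V₂ v) := by
      simp only [hWdef]
      ring
    rw [h3, abs_mul, abs_of_pos (add_pos h1 h2)]
  have hWB : ∀ v, v₀ ≤ v → |W v| ≤ 2 * k * F v := by
    intro v hv
    have hF0 := hFpos v (hav hv)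
    have h1 := (div_le_iff₀ hF0).1 (hv₀ v hv).2.2.1.2
    have h2 := (div_le_iff₀ hF0).1 (hv₀ v hv).2.2.2.2
    rw [abs_le]
    constructor <;> simp only [hWdef] <;> nlinarith [sq_nonneg (V₁ v), sq_nonneg (V₂ v)]
  have htpos : ∀ (V : ℝ → ℝ), (∀ v, a ≤ v → 0 < V v) →
      IntegrableOn (fun s => (V s)⁻¹) (Ici a) → ∀ v, a ≤ v → 0 < ∫ s in Ioi v, (V s)⁻¹ := by
    intro V hV hVi v hv
    rw [setIntegral_pos_iff_support_of_nonneg_ae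
      (ae_restrict_of_forall_mem measurableSet_Ioi fun s hs =>
        (inv_pos.2 (hV s (hv.trans (le_of_lt hs)))).le)
      (hVi.mono_set fun s hs => hv.trans (le_of_lt hs))]
    have hsub : Ioi v ⊆ Function.support (fun s => (V s)⁻¹) ∩ Ioi v := fun s hs =>
      ⟨(inv_pos.2 (hV s (hv.trans (le_of_lt hs)))).ne', hs⟩
    exact lt_of_lt_of_le (by simp) (measure_mono hsub)
  have hinv : ∀ s, v₀ ≤ s →
      |(V₁ s)⁻¹ - (V₂ s)⁻¹| ≤ 1 / (2 * c ^ 3) * (|W s| * (1 / (F s * Real.sqrt (F s)))) := by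
    intro s hs
    have h1 := hV₁pos s (hav hs).le
    have h2 := hV₂pos s (hav hs).le
    have hF0 := hFpos s (hav hs)
    have hr := Real.sqrt_pos.2 hF0
    have hcr : 0 < c * Real.sqrt (F s) := mul_pos hcpos hr
    have h3 : (V₁ s)⁻¹ - (V₂ s)⁻¹ = -(V₁ s - V₂ s) / (V₁ s * V₂ s) := by
      field_simp
      ring
    have h4 : |(V₁ s)⁻¹ - (V₂ s)⁻¹| = |W s| / (V₁ s * V₂ s * (V₁ s + V₂ s)) := by
      rw [h3, abs_div, abs_neg, abs_of_pos (mul_pos h1 h2), hWfac s (hav hs).le]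
      field_simp
    have h5 : 2 * c ^ 3 * (F s * Real.sqrt (F s)) ≤ V₁ s * V₂ s * (V₁ s + V₂ s) :=
      calc 2 * c ^ 3 * (F s * Real.sqrt (F s))
          = c * Real.sqrt (F s) * (c * Real.sqrt (F s)) *
              (c * Real.sqrt (F s) + c * Real.sqrt (F s)) := by
            linear_combination (-2 * c ^ 3 * Real.sqrt (F s)) * Real.sq_sqrt hF0.le
        _ ≤ _ := by
            have := hlow₁ s hs
            have := hlow₂ s hs
            gcongr
    rw [h4]
    calc |W s| / (V₁ s * V₂ s * (V₁ s + V₂ s))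
        ≤ |W s| / (2 * c ^ 3 * (F s * Real.sqrt (F s))) := by gcongr
      _ = _ := by field_simp
  have hmaj : IntegrableOn (fun s => |W s| * (1 / (F s * Real.sqrt (F s)))) (Ioi v₀) := by
    have hFc : ContinuousOn F (Ioi v₀) := fun s hs =>
      (hFd s (hav (le_of_lt hs))).continuousAt.continuousWithinAt
    have hWc : ContinuousOn W (Ioi v₀) := fun s hs =>
      (hWd s (le_of_lt hs)).continuousAt.continuousWithinAt
    have hcont : ContinuousOn (fun s => |W s| * (1 / (F s * Real.sqrt (F s)))) (Ioi v₀) :=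
      hWc.abs.mul (continuousOn_const.div (hFc.mul hFc.sqrt) fun s hs =>
        (mul_pos (hFpos s (hav (le_of_lt hs)))
          (Real.sqrt_pos.2 (hFpos s (hav (le_of_lt hs))))).ne')
    refine Integrable.mono' ((hint.mono_set (Ioi_subset_Ioi hbv₀.le)).const_mul (2 * k))
      (hcont.aestronglyMeasurable measurableSet_Ioi) ?_
    refine ae_restrict_of_forall_mem measurableSet_Ioi fun s hs => ?_
    have hF0 := hFpos s (hav (le_of_lt hs))
    have hr := Real.sqrt_pos.2 hF0
    rw [Real.norm_of_nonneg (by positivity)]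
    calc |W s| * (1 / (F s * Real.sqrt (F s)))
        ≤ 2 * k * F s * (1 / (F s * Real.sqrt (F s))) := by
          gcongr
          exact hWB s (le_of_lt hs)
      _ = 2 * k * (1 / Real.sqrt (F s)) := by field_simp
  have htdiff : ∀ v, v₀ ≤ v → |t₁ v - t₂ v| ≤
      1 / (2 * c ^ 3) * ∫ s in Ioi v, |W s| * (1 / (F s * Real.sqrt (F s))) := by
    intro v hv
    have hsub : Ioi v ⊆ Ici a := fun s hs => ((hav hv).trans hs).le
    rw [ht₁, ht₂, ← integral_sub (hV₁int.mono_set hsub) (hV₂int.mono_set hsub),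
      ← integral_const_mul]
    exact norm_integral_le_of_norm_le (f := fun s => (V₁ s)⁻¹ - (V₂ s)⁻¹)
      ((hmaj.mono_set (Ioi_subset_Ioi hv)).const_mul _)
      (ae_restrict_of_forall_mem measurableSet_Ioi fun s hs => hinv s (hv.trans (le_of_lt hs)))
  have hW' : ∀ v, v₀ ≤ v → |2 * (ρt (t₁ v) - ρt (t₂ v)) * f v| ≤
      (Λ / c ^ 3 : ℝ) * f v * ∫ s in Ioi v, |W s| * (1 / (F s * Real.sqrt (F s))) := by
    intro v hv
    have hav' := (hav hv).le
    have hρ : |ρt (t₁ v) - ρt (t₂ v)| ≤ Λ * |t₁ v - t₂ v| :=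
      hΛ.dist_le_mul _ ⟨ht₁ v ▸ htpos V₁ hV₁pos hV₁int v hav', ht₁le v hav'⟩
        _ ⟨ht₂ v ▸ htpos V₂ hV₂pos hV₂int v hav', ht₂le v hav'⟩
    have hf0 := hfpos v hav'
    rw [abs_mul, abs_mul, abs_of_pos hf0, abs_two]
    calc 2 * |ρt (t₁ v) - ρt (t₂ v)| * f v
        ≤ 2 * (Λ * (1 / (2 * c ^ 3) *
            ∫ s in Ioi v, |W s| * (1 / (F s * Real.sqrt (F s))))) * f v := by
          gcongr
          exact hρ.trans (mul_le_mul_of_nonneg_left (htdiff v hv) Λ.2)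
      _ = _ := by field_simp
  have hWbdd := abs_le_two_mul_of_abs_deriv_le_tail_integral hbv₀
    (div_nonneg Λ.2 (pow_nonneg hcpos.le 3)) (fun v hv => hFd v (hab.trans hv))
    (fun v hv => hFpos v (hab.trans hv)) (fun v hv => (hfpos v (hab.trans hv).le).le) hint hWd hW'
    (hv₀ v₀ le_rfl).2.1 (by positivity) hWB
  refine ⟨|W v₀| / c + 1, by positivity, v₀, (hav le_rfl).le, fun v hv => ?_⟩
  have h1 : Real.sqrt (F v) * |V₁ v - V₂ v| * (2 * c) ≤ |W v| := by
    rw [hWfac v (hav hv).le]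
    calc Real.sqrt (F v) * |V₁ v - V₂ v| * (2 * c)
        = |V₁ v - V₂ v| * (c * Real.sqrt (F v) + c * Real.sqrt (F v)) := by ring
      _ ≤ _ := by
        gcongr
        · exact hlow₁ v hv
        · exact hlow₂ v hv
  have h2 : Real.sqrt (F v) * |V₁ v - V₂ v| ≤ |W v₀| / c := by
    rw [le_div_iff₀ hcpos]
    linarith [hWbdd v hv]
  linarith
end

section
/- Let D ≥ 3 and let c_D |x|^{2−D} be the fundamental solution of the Laplace operator on ℝ^D. Let h ∈ L^∞_loc(ℝ^D) with h ≥ 0 almost everywhere. Then there exists a bounded solution U of −ΔU = h in ℝ^D if and only if the Newtonian potential u⋆(x) := c_D ∫_{ℝ^D} |x−y|^{2−D} h(y) dy belongs to L^∞(ℝ^D). Furthermore, in that case u⋆ is the minimal positive solution of −ΔU = h in ℝ^D: every positive solution U satisfies U ≥ u⋆. -/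
open MeasureTheory Filter Set Metric

noncomputable def laplacian {D : ℕ} (u : EuclideanSpace ℝ (Fin D) → ℝ)
    (x : EuclideanSpace ℝ (Fin D)) : ℝ :=
  ∑ i, fderiv ℝ (fun y => fderiv ℝ u y (EuclideanSpace.single i 1)) x (EuclideanSpace.single i 1)

/-- `U` is a distributional solution of `−ΔU = h` on `ℝ^D`. -/
def IsDistribSol {D : ℕ} (h U : EuclideanSpace ℝ (Fin D) → ℝ) : Prop :=
  LocallyIntegrable U volume ∧
    ∀ φ : EuclideanSpace ℝ (Fin D) → ℝ, ContDiff ℝ (⊤ : ℕ∞) φ → HasCompactSupport φ →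
      ∫ x, U x * laplacian φ x = -∫ x, h x * φ x


open scoped Topology Convolution ContDiff

section Smooth

variable {D : ℕ}

/-- The directional derivative of a smooth function is smooth. -/
lemma ContDiff.fderiv_apply_smooth {u : EuclideanSpace ℝ (Fin D) → ℝ} (hu : ContDiff ℝ ∞ u)
    (v : EuclideanSpace ℝ (Fin D)) :
    ContDiff ℝ ∞ (fun y => fderiv ℝ u y v) :=
  (hu.fderiv_right (m := ∞) (by simp)).clm_apply contDiff_const

lemma ContDiff.continuous_laplacian {u : EuclideanSpace ℝ (Fin D) → ℝ} (hu : ContDiff ℝ ∞ u) :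
    Continuous (laplacian u) :=
  continuous_finsetSum _ fun i _ =>
    ((hu.fderiv_apply_smooth (EuclideanSpace.single i 1)).fderiv_apply_smooth
      (EuclideanSpace.single i 1)).continuous

lemma HasCompactSupport.laplacian {u : EuclideanSpace ℝ (Fin D) → ℝ} (hu : HasCompactSupport u) :
    HasCompactSupport (laplacian u) := by
  refine hu.mono' fun x hx => ?_
  by_contra hxu
  apply hx
  refine Finset.sum_eq_zero fun i _ => ?_
  have h1 : (fun y => fderiv ℝ u y (EuclideanSpace.single i 1)) =ᶠ[𝓝 x] fun _ => 0 := by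
    filter_upwards [(isClosed_tsupport u).isOpen_compl.mem_nhds hxu] with y hy
    have : fderiv ℝ u y = 0 := by
      by_contra hne
      exact hy (support_fderiv_subset ℝ hne)
    simp [this]
  rw [h1.fderiv_eq]
  simp

lemma laplacian_comp_sub_left {u : EuclideanSpace ℝ (Fin D) → ℝ} (x y : EuclideanSpace ℝ (Fin D)) :
    laplacian (fun z => u (x - z)) y = laplacian u (x - y) := by
  have key : ∀ (f : EuclideanSpace ℝ (Fin D) → ℝ) (z : EuclideanSpace ℝ (Fin D)), fderiv ℝ
      (fun z => f (x - z)) z = -fderiv ℝ f (x - z) := by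
    intro f z
    have h1 := (ContinuousLinearEquiv.neg ℝ (M := EuclideanSpace ℝ (Fin D))).comp_right_fderiv
      (f := fun w => f (x + w)) (x := z)
    have h2 : (fun w => f (x + w)) ∘
      (ContinuousLinearEquiv.neg ℝ (M := EuclideanSpace ℝ (Fin D))) = fun z => f (x - z) := by
      ext w
      simp [sub_eq_add_neg]
    rw [h2, fderiv_comp_add_left] at h1
    rw [h1]
    ext v
    simp [sub_eq_add_neg]
  unfold laplacian
  refine Finset.sum_congr rfl fun i _ => ?_
  simp only [key, neg_apply, fderiv_fun_neg]
  have h2 := key (fun z => fderiv ℝ u z (EuclideanSpace.single i 1)) y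
  simp only [h2]
  simp

/-- Differentiation of a convolution falls on the smooth factor. -/
lemma fderiv_integral_mul_sub {W ρ : EuclideanSpace ℝ (Fin D) → ℝ} (hW : LocallyIntegrable W volume)
    (hρ : ContDiff ℝ ∞ ρ) (hc : HasCompactSupport ρ) (x v : EuclideanSpace ℝ (Fin D)) :
    fderiv ℝ (fun x => ∫ t, W t * ρ (x - t)) x v = ∫ t, W t * fderiv ℝ ρ (x - t) v := by
  have h1 := (hc.hasFDerivAt_convolution_right (ContinuousLinearMap.mul ℝ ℝ) hW
    (hρ.of_le (by simp)) x).fderiv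
  have h2 : (W ⋆[ContinuousLinearMap.mul ℝ ℝ, volume] ρ) = fun x => ∫ t, W t * ρ (x - t) := rfl
  rw [h2] at h1
  rw [h1, convolution_precompR_apply _ hW (hc.fderiv ℝ) (hρ.continuous_fderiv (by simp))]
  rfl

lemma contDiff_integral_mul_sub {W ρ : EuclideanSpace ℝ (Fin D) → ℝ}
    (hW : LocallyIntegrable W volume)
    (hρ : ContDiff ℝ ∞ ρ) (hc : HasCompactSupport ρ) :
    ContDiff ℝ ∞ (fun x => ∫ t, W t * ρ (x - t)) :=
  hc.contDiff_convolution_right (ContinuousLinearMap.mul ℝ ℝ) hW hρ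

lemma HasCompactSupport.comp_const_sub {ρ : EuclideanSpace ℝ (Fin D) → ℝ}
    (hc : HasCompactSupport ρ) (x : EuclideanSpace ℝ (Fin D)) :
    HasCompactSupport (fun t => ρ (x - t)) :=
  hc.comp_homeomorph (Homeomorph.subLeft x)

lemma MeasureTheory.LocallyIntegrable.integrable_mul_of_hasCompactSupport
    {W ρ : EuclideanSpace ℝ (Fin D) → ℝ}
    (hW : LocallyIntegrable W volume) (hρ : Continuous ρ) (hc : HasCompactSupport ρ) :
    Integrable (fun t => W t * ρ t) :=
  hW.integrable_smul_right_of_hasCompactSupport hρ hc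

lemma laplacian_integral_mul_sub {W ρ : EuclideanSpace ℝ (Fin D) → ℝ}
    (hW : LocallyIntegrable W volume)
    (hρ : ContDiff ℝ ∞ ρ) (hc : HasCompactSupport ρ) (x : EuclideanSpace ℝ (Fin D)) :
    laplacian (fun x => ∫ t, W t * ρ (x - t)) x
      = ∫ t, W t * laplacian (fun z => ρ (x - z)) t := by
  simp only [laplacian_comp_sub_left]
  unfold laplacian
  simp only [fderiv_integral_mul_sub hW hρ hc, Finset.mul_sum]
  rw [integral_finsetSum]
  · refine Finset.sum_congr rfl fun i _ => ?_
    exact fderiv_integral_mul_sub hW (hρ.fderiv_apply_smooth _) (hc.fderiv_apply ℝ _) _ _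
  · intro i _
    refine LocallyIntegrable.integrable_mul_of_hasCompactSupport (ρ := fun t =>
      fderiv ℝ (fun y => fderiv ℝ ρ y (EuclideanSpace.single i 1)) (x - t)
        (EuclideanSpace.single i 1)) hW ?_ ?_
    · exact ((hρ.fderiv_apply_smooth (EuclideanSpace.single i 1)).fderiv_apply_smooth
        (EuclideanSpace.single i 1)).continuous.comp (by fun_prop)
    · exact HasCompactSupport.comp_const_sub (ρ := fun t =>
        fderiv ℝ (fun y => fderiv ℝ ρ y (EuclideanSpace.single i 1)) t
        (EuclideanSpace.single i 1)) ((hc.fderiv_apply ℝ _).fderiv_apply ℝ _) x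

/-- Necessary second-order condition at a local minimum. -/
lemma IsLocalMin.deriv_deriv_nonneg {f : ℝ → ℝ} {x : ℝ} (hmin : IsLocalMin f x)
    (hc : ContinuousAt f x) : 0 ≤ deriv (deriv f) x := by
  by_contra! hneg
  have hmax := isLocalMax_of_deriv_deriv_neg hneg hmin.deriv_eq_zero hc
  have hconst : f =ᶠ[𝓝 x] fun _ => f x := by
    filter_upwards [hmin, hmax] with y h1 h2 using le_antisymm h2 h1
  have : deriv (deriv f) x = 0 := by
    rw [hconst.deriv.deriv_eq]
    simp
  exact hneg.ne this

lemma deriv_comp_line {u : EuclideanSpace ℝ (Fin D) → ℝ} (hu : Differentiable ℝ u)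
    (y v : EuclideanSpace ℝ (Fin D)) (t : ℝ) :
    deriv (fun s : ℝ => u (y + s • v)) t = fderiv ℝ u (y + t • v) v := by
  have h1 : HasDerivAt (fun s : ℝ => y + s • v) v t := by
    simpa using ((hasDerivAt_id t).smul_const v).const_add y
  exact ((hu (y + t • v)).hasFDerivAt.comp_hasDerivAt t h1).deriv

lemma IsLocalMin.laplacian_nonneg {u : EuclideanSpace ℝ (Fin D) → ℝ} (hu : ContDiff ℝ ∞ u)
    {y : EuclideanSpace ℝ (Fin D)}
    (hy : IsLocalMin u y) : 0 ≤ _root_.laplacian u y := by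
  refine Finset.sum_nonneg fun i _ => ?_
  set e : EuclideanSpace ℝ (Fin D) := EuclideanSpace.single i 1
  have hcont : Continuous fun s : ℝ => y + s • e := by fun_prop
  have hline : IsLocalMin (fun s : ℝ => u (y + s • e)) 0 := by
    have ht : Tendsto (fun s : ℝ => y + s • e) (𝓝 0) (𝓝 y) := by
      simpa using hcont.tendsto 0
    have := ht.eventually hy
    filter_upwards [this] with s hs
    simpa using hs
  have h0 := hline.deriv_deriv_nonneg (hu.continuous.comp hcont).continuousAt
  have h1 : deriv (fun s : ℝ => u (y + s • e)) = fun s => fderiv ℝ u (y + s • e) e :=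
    funext (deriv_comp_line (hu.differentiable (by simp)) y e)
  rw [h1, deriv_comp_line ((hu.fderiv_apply_smooth e).differentiable (by simp))] at h0
  simpa using h0

lemma laplacian_sub_mul_norm_sq {u : EuclideanSpace ℝ (Fin D) → ℝ} (hu : ContDiff ℝ ∞ u) (η : ℝ)
    (y : EuclideanSpace ℝ (Fin D)) :
    laplacian (fun x => u x - η * ‖x‖ ^ 2) y = laplacian u y - 2 * D * η := by
  have h1 : ∀ (e z : EuclideanSpace ℝ (Fin D)), fderiv ℝ (fun x => u x - η * ‖x‖ ^ 2) z e
      = fderiv ℝ u z e - η * (2 * inner ℝ z e) := by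
    intro e z
    have hq : HasFDerivAt (fun x : EuclideanSpace ℝ (Fin D) => ‖x‖ ^ 2) (2 • innerSL ℝ z) z :=
      (hasStrictFDerivAt_norm_sq z).hasFDerivAt
    rw [((hu.differentiable (by simp) z).hasFDerivAt.fun_sub (hq.const_mul η)).fderiv]
    simp
  have h2 : ∀ (e z : EuclideanSpace ℝ (Fin D)), fderiv ℝ
      (fun x => fderiv ℝ u x e - η * (2 * inner ℝ x e)) z e
      = fderiv ℝ (fun x => fderiv ℝ u x e) z e - η * (2 * inner ℝ e e) := by
    intro e z
    have hq : HasFDerivAt (fun x : EuclideanSpace ℝ (Fin D) => inner ℝ x e) (innerSL ℝ e) z := by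
      have := (innerSL ℝ e).hasFDerivAt (x := z)
      refine this.congr_of_eventuallyEq (Eventually.of_forall fun x => ?_)
      exact real_inner_comm e x
    rw [(((hu.fderiv_apply_smooth e).differentiable (by simp) z).hasFDerivAt.fun_sub
      ((hq.const_mul 2).const_mul η)).fderiv]
    simp
  unfold laplacian
  simp only [h1, h2]
  rw [Finset.sum_sub_distrib]
  simp
  ring

/-- Minimum principle at infinity for smooth superharmonic functions. -/
lemma le_of_laplacian_nonpos (hD : 0 < D) {w : EuclideanSpace ℝ (Fin D) → ℝ} (hw : ContDiff ℝ ∞ w)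
    (hlap : ∀ x, laplacian w x ≤ 0) {c : ℝ}
    (hinf : ∀ ε > 0, ∃ R : ℝ, ∀ x, R ≤ ‖x‖ → c - ε ≤ w x) (x : EuclideanSpace ℝ (Fin D)) : c
      ≤ w x := by
  refine le_of_forall_pos_le_add fun ε hε => ?_
  obtain ⟨R₀, hR₀⟩ := hinf (ε / 2) (by positivity)
  set R : ℝ := max (max R₀ ‖x‖) 1
  have hR1 : 1 ≤ R := le_max_right _ _
  have hRx : ‖x‖ ≤ R := (le_max_right _ _).trans (le_max_left _ _)
  have hRR : R₀ ≤ R := (le_max_left _ _).trans (le_max_left _ _)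
  set η : ℝ := ε / 2 / R ^ 2
  have hη : 0 < η := by positivity
  have hηR : η * R ^ 2 = ε / 2 := by simp only [η]; field_simp
  have hg : ContDiff ℝ ∞ fun z => w z - η * ‖z‖ ^ 2 :=
    hw.sub (contDiff_const.mul (contDiff_norm_sq ℝ))
  obtain ⟨y, hyR, hy⟩ := (isCompact_closedBall (0 : EuclideanSpace ℝ (Fin D)) R).exists_isMinOn
    ⟨x, by simpa using hRx⟩ hg.continuous.continuousOn
  have hyx : w y - η * ‖y‖ ^ 2 ≤ w x - η * ‖x‖ ^ 2 := hy (by simpa using hRx)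
  have hyR' : ‖y‖ ≤ R := by simpa using hyR
  have hx0 : 0 ≤ η * ‖x‖ ^ 2 := by positivity
  rcases hyR'.lt_or_eq with hlt | heq
  · have hmin : IsLocalMin (fun z => w z - η * ‖z‖ ^ 2) y :=
      hy.isLocalMin (closedBall_mem_nhds_of_mem (by simpa using hlt))
    have h1 := hmin.laplacian_nonneg hg
    rw [laplacian_sub_mul_norm_sq hw] at h1
    have h2 := hlap y
    have : 0 < 2 * (D : ℝ) * η := by positivity
    linarith
  · have h1 := hR₀ y (by rw [heq]; exact hRR)
    rw [heq, hηR] at hyx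
    linarith

end Smooth

section Weak

variable {D : ℕ}

lemma le_integral_mul_bump_sub {W : EuclideanSpace ℝ (Fin D) → ℝ} (hW : LocallyIntegrable W volume)
    {c R : ℝ}
    (hR : ∀ᵐ x, R ≤ ‖x‖ → c ≤ W x) (f : ContDiffBump (0 : EuclideanSpace ℝ (Fin D)))
      {x : EuclideanSpace ℝ (Fin D)} (hx : R + f.rOut ≤ ‖x‖) :
    c ≤ ∫ t, W t * f.normed volume (x - t) := by
  have hcont : Continuous fun t => f.normed volume (x - t) :=
    f.continuous_normed.comp (by fun_prop)
  have hcomp := f.hasCompactSupport_normed (μ := volume).comp_const_sub x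
  have h1 : ∫ t, c * f.normed volume (x - t) = c := by
    rw [integral_const_mul, integral_sub_left_eq_self (fun z => f.normed volume z),
      f.integral_normed, mul_one]
  rw [← h1]
  refine integral_mono_ae ((hcont.integrable_of_hasCompactSupport hcomp).const_mul c)
    (hW.integrable_mul_of_hasCompactSupport hcont hcomp) ?_
  filter_upwards [hR] with t ht
  by_cases hz : f.normed volume (x - t) = 0
  · simp [hz]
  · have hmem : x - t ∈ ball (0 : EuclideanSpace ℝ (Fin D)) f.rOut := by
      rw [← f.support_normed_eq (μ := volume)]
      exact hz
    have h2 : ‖x - t‖ < f.rOut := by simpa using hmem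
    have h3 : ‖x‖ ≤ ‖x - t‖ + ‖t‖ := by simpa using norm_add_le (x - t) t
    exact mul_le_mul_of_nonneg_right (ht (by linarith)) (f.nonneg_normed _)

/-- Minimum principle at infinity for superharmonic functions in the sense of distributions. -/
lemma ae_le_of_integral_mul_laplacian_nonpos (hD : 0 < D) {W : EuclideanSpace ℝ (Fin D) → ℝ}
    (hW : LocallyIntegrable W volume)
    (hsup : ∀ φ : EuclideanSpace ℝ (Fin D) →
      ℝ, ContDiff ℝ ∞ φ → HasCompactSupport φ → (∀ x, 0 ≤ φ x) →
      ∫ x, W x * laplacian φ x ≤ 0) {c : ℝ}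
    (hinf : ∀ ε > 0, ∃ R : ℝ, ∀ᵐ x, R ≤ ‖x‖ → c - ε ≤ W x) : ∀ᵐ x, c ≤ W x := by
  let f : ℕ → ContDiffBump (0 : EuclideanSpace ℝ (Fin D)) := fun n =>
    ⟨1 / ((n : ℝ) + 1), 2 * (1 / ((n : ℝ) + 1)), by positivity,
      lt_two_mul_self (by positivity)⟩
  have hlim : Tendsto (fun n => (f n).rOut) atTop (𝓝 0) := by
    simpa only [mul_zero] using
      (tendsto_one_div_add_atTop_nhds_zero_nat (𝕜 := ℝ)).const_mul 2
  have hconv := ContDiffBump.ae_convolution_tendsto_right_of_locallyIntegrable (μ := volume)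
    (K := 2) hlim (Eventually.of_forall fun n => le_rfl) hW
  filter_upwards [hconv] with x hx
  refine ge_of_tendsto' hx fun n => ?_
  have heq : ((f n).normed volume ⋆[ContinuousLinearMap.lsmul ℝ ℝ, volume] W) x
      = ∫ t, W t * (f n).normed volume (x - t) := by
    rw [convolution_eq_swap]
    simp [mul_comm]
  rw [heq]
  have hsm : ContDiff ℝ ∞ ((f n).normed volume) := (f n).contDiff_normed
  have hcs : HasCompactSupport ((f n).normed volume) := (f n).hasCompactSupport_normed
  refine le_of_laplacian_nonpos hD (contDiff_integral_mul_sub hW hsm hcs) (fun z => ?_)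
    (fun ε hε => ?_) x
  · rw [laplacian_integral_mul_sub hW hsm hcs]
    exact hsup _ (hsm.comp (by fun_prop)) (hcs.comp_const_sub z) fun t => (f n).nonneg_normed _
  · obtain ⟨R, hR⟩ := hinf ε hε
    exact ⟨R + (f n).rOut, fun z hz => le_integral_mul_bump_sub hW hR (f n) hz⟩

/-- A nonnegative even fundamental solution of `-Δ` vanishing at infinity. -/
structure IsGreenKernel (K : EuclideanSpace ℝ (Fin D) → ℝ) : Prop where
  measurable : Measurable K
  nonneg : ∀ x, 0 ≤ K x
  even : ∀ x, K (-x) = K x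
  continuousAt : ∀ x ≠ 0, ContinuousAt K x
  locallyIntegrable : LocallyIntegrable K volume
  decay : ∀ ε > 0, ∃ S : ℝ, ∀ x, S ≤ ‖x‖ → K x ≤ ε
  fundamental : ∀ φ : EuclideanSpace ℝ (Fin D) → ℝ, ContDiff ℝ ∞ φ → HasCompactSupport φ →
    ∫ x, K x * laplacian φ x = -φ 0

/-- The potential of `g` with kernel `K`. -/
noncomputable def potential (K g : EuclideanSpace ℝ (Fin D) → ℝ) (x : EuclideanSpace ℝ (Fin D)) :
    ENNReal :=
  ∫⁻ y, ENNReal.ofReal (K (x - y) * g y)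

namespace IsGreenKernel

variable {K : EuclideanSpace ℝ (Fin D) → ℝ}

lemma integral_sub_mul_laplacian (hK : IsGreenKernel K) {φ : EuclideanSpace ℝ (Fin D) → ℝ}
    (hφ : ContDiff ℝ ∞ φ)
    (hc : HasCompactSupport φ) (y : EuclideanSpace ℝ (Fin D)) : ∫ x, K
      (x - y) * laplacian φ x = -φ y := by
  have h1 : ∀ x, K (x - y) * laplacian φ x
      = (fun z => K z * laplacian (fun z => φ (y - z)) z) (y - x) := by
    intro x
    simp only [laplacian_comp_sub_left, sub_sub_cancel]
    rw [← hK.even, neg_sub]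
  simp only [h1]
  rw [integral_sub_left_eq_self (fun z => K z * laplacian (fun z => φ (y - z)) z),
    hK.fundamental (fun z => φ (y - z)) (hφ.comp (by fun_prop)) (hc.comp_const_sub y), sub_zero]

lemma aestronglyMeasurable_prod (hK : IsGreenKernel K) {g : EuclideanSpace ℝ (Fin D) → ℝ}
    (hg : AEStronglyMeasurable g volume) :
    AEStronglyMeasurable
      (fun p : EuclideanSpace ℝ (Fin D) × EuclideanSpace ℝ (Fin D) => K (p.1 - p.2) * g p.2)
        (volume.prod volume) :=
  (hK.measurable.comp (measurable_fst.sub measurable_snd)).aestronglyMeasurable.mul hg.comp_snd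

lemma aemeasurable_potential (hK : IsGreenKernel K) {g : EuclideanSpace ℝ (Fin D) → ℝ}
    (hg : AEStronglyMeasurable g volume) : AEMeasurable (potential K g) :=
  (hK.aestronglyMeasurable_prod hg).aemeasurable.ennreal_ofReal.lintegral_prod_right'

lemma aestronglyMeasurable_section (hK : IsGreenKernel K) {g : EuclideanSpace ℝ (Fin D) → ℝ}
    (hg : AEStronglyMeasurable g volume) (x : EuclideanSpace ℝ (Fin D)) :
    AEStronglyMeasurable (fun y => K (x - y) * g y) volume :=
  (hK.measurable.comp (measurable_const.sub measurable_id)).aestronglyMeasurable.mul hg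

/-- A bounded potential of `g` solves `-Δu = g`. -/
lemma isDistribSol_potential (hK : IsGreenKernel K) {g : EuclideanSpace ℝ (Fin D) → ℝ}
    (hg : AEStronglyMeasurable g volume) (hg0 : ∀ᵐ y, 0 ≤ g y) {C : ℝ}
    (hC : ∀ x, potential K g x ≤ ENNReal.ofReal C) :
    IsDistribSol g fun x => (potential K g x).toReal := by
  refine ⟨?_, fun φ hφ hc => ?_⟩
  · refine (locallyIntegrable_const (max C 0)).mono
      (hK.aemeasurable_potential hg).ennreal_toReal.aestronglyMeasurable
      (Eventually.of_forall fun x => ?_)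
    rw [Real.norm_of_nonneg ENNReal.toReal_nonneg, Real.norm_of_nonneg (le_max_right _ _)]
    have := ENNReal.toReal_mono ENNReal.ofReal_ne_top (hC x)
    rwa [ENNReal.toReal_ofReal'] at this
  · have hψ := hφ.continuous_laplacian
    have hψc := hc.laplacian
    have h1 : ∀ x, (potential K g x).toReal = ∫ y, K (x - y) * g y := by
      intro x
      rw [integral_eq_lintegral_of_nonneg_ae _ (hK.aestronglyMeasurable_section hg x), potential]
      filter_upwards [hg0] with y hy using mul_nonneg (hK.nonneg _) hy
    have hint : Integrable
      (fun p : EuclideanSpace ℝ (Fin D) × EuclideanSpace ℝ (Fin D) =>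
        K (p.1 - p.2) * g p.2 * laplacian φ p.1)
        (volume.prod volume) := by
      have hm : AEStronglyMeasurable
          (fun p : EuclideanSpace ℝ (Fin D) × EuclideanSpace ℝ (Fin D) =>
            K (p.1 - p.2) * g p.2 * laplacian φ p.1) (volume.prod volume) :=
        (hK.aestronglyMeasurable_prod hg).mul hψ.aestronglyMeasurable.comp_fst
      refine ⟨hm, ?_⟩
      rw [HasFiniteIntegral, lintegral_prod _ hm.enorm]
      have h2 : ∀ x, ∫⁻ y, ‖K (x - y) * g y * laplacian φ x‖ₑ
          ≤ ENNReal.ofReal C * ‖laplacian φ x‖ₑ := by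
        intro x
        simp only [enorm_mul (_ * _)]
        rw [lintegral_mul_const' _ _ enorm_ne_top]
        gcongr
        refine le_trans (le_of_eq ?_) (hC x)
        refine lintegral_congr_ae ?_
        filter_upwards [hg0] with y hy
        exact Real.enorm_of_nonneg (mul_nonneg (hK.nonneg _) hy)
      refine (lintegral_mono h2).trans_lt ?_
      rw [lintegral_const_mul' _ _ ENNReal.ofReal_ne_top]
      exact ENNReal.mul_lt_top ENNReal.ofReal_lt_top
        (hψ.integrable_of_hasCompactSupport hψc).hasFiniteIntegral
    simp only [h1, ← integral_mul_const]
    rw [integral_integral_swap hint, ← integral_neg]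
    congr 1
    ext y
    have h3 : ∀ x, K (x - y) * g y * laplacian φ x = g y * (K (x - y) * laplacian φ x) :=
      fun x => by ring
    simp only [h3, integral_const_mul, hK.integral_sub_mul_laplacian hφ hc]
    ring

/-- An almost everywhere bound on a potential holds everywhere. -/
lemma potential_le_of_ae_le (hD : 0 < D) (hK : IsGreenKernel K) {g : EuclideanSpace ℝ (Fin D) → ℝ}
    (hg : AEStronglyMeasurable g volume) {a : ENNReal} (ha : ∀ᵐ x, potential K g x ≤ a)
      (x : EuclideanSpace ℝ (Fin D)) :
    potential K g x ≤ a := by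
  have : Nonempty (Fin D) := ⟨⟨0, hD⟩⟩
  obtain ⟨s, hs, hsx⟩ := mem_closure_iff_seq_limit.1
    ((Measure.dense_of_ae ha).closure_eq ▸ mem_univ x)
  calc potential K g x
      ≤ ∫⁻ y, liminf (fun n => ENNReal.ofReal (K (s n - y) * g y)) atTop := by
        refine lintegral_mono_ae ?_
        filter_upwards [Measure.ae_ne volume x] with y hy
        have h1 : Tendsto (fun n => K (s n - y)) atTop (𝓝 (K (x - y))) :=
          (hK.continuousAt (x - y) (sub_ne_zero.2 (Ne.symm hy))).tendsto.comp
            (hsx.sub_const y)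
        exact (ENNReal.tendsto_ofReal (h1.mul_const (g y))).liminf_eq.ge
    _ ≤ liminf (fun n => potential K g (s n)) atTop :=
        lintegral_liminf_le' fun n =>
          (hK.aestronglyMeasurable_section hg _).aemeasurable.ennreal_ofReal
    _ ≤ liminf (fun _ : ℕ => a) atTop := liminf_le_liminf (Eventually.of_forall hs)
    _ = a := liminf_const a

lemma potential_indicator (K h : EuclideanSpace ℝ (Fin D) → ℝ) (R : ℝ)
    (x : EuclideanSpace ℝ (Fin D)) :
    potential K ((ball 0 R).indicator h) x
      = ∫⁻ y in ball 0 R, ENNReal.ofReal (K (x - y) * h y) := by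
  rw [← lintegral_indicator measurableSet_ball, potential]
  refine lintegral_congr fun y => ?_
  by_cases hy : y ∈ ball
      (0 : EuclideanSpace ℝ (Fin D)) R <;> simp only [hy, indicator_of_mem, indicator_of_notMem,
    not_false_eq_true, mul_zero, ENNReal.ofReal_zero]

lemma potential_eq_iSup (K h : EuclideanSpace ℝ (Fin D) → ℝ) (x : EuclideanSpace ℝ (Fin D)) :
    potential K h x = ⨆ n : ℕ, potential K ((ball 0 (n : ℝ)).indicator h) x := by
  simp only [potential_indicator]
  rw [← setLIntegral_iUnion_of_directed, iUnion_ball_nat, Measure.restrict_univ, potential]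
  exact Monotone.directed_le fun m n hmn => ball_subset_ball (by exact_mod_cast hmn)

lemma potential_indicator_le (hK : IsGreenKernel K) {h : EuclideanSpace ℝ (Fin D) → ℝ} {R M : ℝ}
    (hM : ∀ᵐ y, y ∈ ball (0 : EuclideanSpace ℝ (Fin D)) R → h y ≤ M)
      (x : EuclideanSpace ℝ (Fin D)) :
    potential K ((ball 0 R).indicator h) x
      ≤ (∫⁻ y in ball 0 R, ENNReal.ofReal (K (x - y))) * ENNReal.ofReal M := by
  rw [potential_indicator, ← lintegral_mul_const' _ _ ENNReal.ofReal_ne_top]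
  refine lintegral_mono_ae ((ae_restrict_iff' measurableSet_ball).2 ?_)
  filter_upwards [hM] with y hy hyR
  rw [← ENNReal.ofReal_mul (hK.nonneg _)]
  exact ENNReal.ofReal_le_ofReal (mul_le_mul_of_nonneg_left (hy hyR) (hK.nonneg _))

lemma exists_potential_indicator_le (hK : IsGreenKernel K) {h : EuclideanSpace ℝ (Fin D) → ℝ}
    {R M : ℝ}
    (hM : ∀ᵐ y, y ∈ ball (0 : EuclideanSpace ℝ (Fin D)) R → h y ≤ M) :
    ∃ C : ℝ, ∀ x, potential K ((ball 0 R).indicator h) x ≤ ENNReal.ofReal C := by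
  obtain ⟨S, hS⟩ := hK.decay 1 one_pos
  set B : ENNReal := (∫⁻ z in ball 0 S, ENNReal.ofReal (K z)) + volume
      (ball (0 : EuclideanSpace ℝ (Fin D)) R)
  have hB : B ≠ ⊤ := by
    refine ENNReal.add_ne_top.2 ⟨?_, measure_ball_lt_top.ne⟩
    have h1 : IntegrableOn K (ball 0 S) :=
      (hK.locallyIntegrable.integrableOn_isCompact (isCompact_closedBall 0 S)).mono_set
        ball_subset_closedBall
    exact h1.lintegral_lt_top.ne
  refine ⟨(B * ENNReal.ofReal M).toReal, fun x => ?_⟩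
  rw [ENNReal.ofReal_toReal (ENNReal.mul_ne_top hB ENNReal.ofReal_ne_top)]
  refine (hK.potential_indicator_le hM x).trans ?_
  gcongr
  have h2 : ∀ y, ENNReal.ofReal (K (x - y))
      ≤ (ball 0 S).indicator (fun z => ENNReal.ofReal (K z)) (x - y) + 1 := by
    intro y
    by_cases hy : x - y ∈ ball (0 : EuclideanSpace ℝ (Fin D)) S
    · rw [indicator_of_mem hy]
      exact le_self_add
    · rw [indicator_of_notMem hy, zero_add, ← ENNReal.ofReal_one]
      exact ENNReal.ofReal_le_ofReal (hS _ (by simpa using hy))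
  refine (lintegral_mono h2).trans ?_
  rw [lintegral_add_right _ measurable_const, setLIntegral_const, one_mul]
  refine add_le_add ((setLIntegral_le_lintegral _ _).trans ?_) le_rfl
  rw [lintegral_sub_left_eq_self (fun z => (ball 0 S).indicator (fun z => ENNReal.ofReal (K z)) z),
    lintegral_indicator measurableSet_ball]

lemma potential_indicator_decay (hK : IsGreenKernel K) {h : EuclideanSpace ℝ (Fin D) → ℝ} {R M : ℝ}
    (hM : ∀ᵐ y, y ∈ ball (0 : EuclideanSpace ℝ (Fin D)) R → h y ≤ M) {ε : ℝ} (hε : 0 < ε) :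
    ∃ S : ℝ, ∀ x, S ≤ ‖x‖ → (potential K ((ball 0 R).indicator h) x).toReal ≤ ε := by
  set v : ℝ := (volume (ball (0 : EuclideanSpace ℝ (Fin D)) R)).toReal
  have hv : 0 ≤ v := ENNReal.toReal_nonneg
  set δ : ℝ := ε / (v * max M 0 + 1)
  have hpos : 0 < v * max M 0 + 1 := by positivity
  have hδ : 0 < δ := by positivity
  obtain ⟨S, hS⟩ := hK.decay δ hδ
  refine ⟨S + R, fun x hx => ?_⟩
  have h1 : ∫⁻ y in ball 0 R, ENNReal.ofReal (K (x - y))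
      ≤ ENNReal.ofReal δ * volume (ball (0 : EuclideanSpace ℝ (Fin D)) R) := by
    rw [← setLIntegral_const]
    refine setLIntegral_mono measurable_const fun y hy => ENNReal.ofReal_le_ofReal (hS _ ?_)
    have h2 : ‖y‖ < R := by simpa using hy
    have h3 := norm_sub_norm_le x y
    linarith
  have h4 : potential K ((ball 0 R).indicator h) x
      ≤ ENNReal.ofReal δ * volume (ball (0 : EuclideanSpace ℝ (Fin D)) R) * ENNReal.ofReal M :=
    (hK.potential_indicator_le hM x).trans (by gcongr)
  refine (ENNReal.toReal_mono (ENNReal.mul_ne_top (ENNReal.mul_ne_top ENNReal.ofReal_ne_top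
    measure_ball_lt_top.ne) ENNReal.ofReal_ne_top) h4).trans ?_
  rw [ENNReal.toReal_mul, ENNReal.toReal_mul, ENNReal.toReal_ofReal hδ.le,
    ENNReal.toReal_ofReal']
  calc δ * v * max M 0 ≤ δ * (v * max M 0 + 1) := by nlinarith
    _ = ε := by simp only [δ]; field_simp

/-- Comparison of a solution bounded below with the potential of the right-hand side. -/
lemma potential_le_of_isDistribSol (hD : 0 < D) (hK : IsGreenKernel K)
    {h : EuclideanSpace ℝ (Fin D) → ℝ}
    (hmeas : AEStronglyMeasurable h volume)
    (hloc : ∀ r : ℝ, 0 < r → ∃ C : ℝ, ∀ᵐ x, x ∈ ball (0 : EuclideanSpace ℝ (Fin D)) r → |h x| ≤ C)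
    (hnonneg : ∀ᵐ x, 0 ≤ h x) {U : EuclideanSpace ℝ (Fin D) → ℝ} (hU : IsDistribSol h U) {c : ℝ}
    (hc : ∀ᵐ x, c ≤ U x) : ∀ᵐ x, potential K h x ≤ ENNReal.ofReal (U x - c) := by
  have hloch : LocallyIntegrable h volume := by
    intro x
    obtain ⟨C, hC⟩ := hloc (‖x‖ + 1) (by positivity)
    refine ⟨ball 0 (‖x‖ + 1), isOpen_ball.mem_nhds (by simp), ?_⟩
    exact Measure.integrableOn_of_bounded measure_ball_lt_top.ne hmeas
      ((ae_restrict_iff' measurableSet_ball).2 hC)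
  have hn : ∀ n : ℕ, ∀ᵐ x,
      potential K ((ball 0 (n : ℝ)).indicator h) x ≤ ENNReal.ofReal (U x - c) := by
    intro n
    obtain ⟨M, hM'⟩ := hloc (n + 1) (by positivity)
    have hM : ∀ᵐ y, y ∈ ball (0 : EuclideanSpace ℝ (Fin D)) n → h y ≤ M := by
      filter_upwards [hM'] with y hy hyn
      exact (le_abs_self _).trans (hy (ball_subset_ball (by linarith) hyn))
    obtain ⟨C, hC⟩ := hK.exists_potential_indicator_le hM
    have hgm : AEStronglyMeasurable ((ball (0 : EuclideanSpace ℝ (Fin D)) n).indicator h) volume :=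
      hmeas.indicator measurableSet_ball
    have hV := hK.isDistribSol_potential hgm
      (by filter_upwards [hnonneg] with y hy using indicator_apply_nonneg fun _ => hy) hC
    have hW : LocallyIntegrable
        (fun x => U x - (potential K ((ball 0 (n : ℝ)).indicator h) x).toReal) volume :=
      hU.1.sub hV.1
    have key := ae_le_of_integral_mul_laplacian_nonpos hD hW (c := c) ?_ ?_
    · filter_upwards [key] with x hx
      have hfin := ne_top_of_le_ne_top ENNReal.ofReal_ne_top (hC x)
      rw [← ENNReal.ofReal_toReal hfin]
      exact ENNReal.ofReal_le_ofReal (by linarith)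
    · intro φ hφ hφc hφ0
      have hψ := hφ.continuous_laplacian
      have hψc := hφc.laplacian
      simp only [sub_mul]
      rw [integral_sub (hU.1.integrable_mul_of_hasCompactSupport hψ hψc)
        (hV.1.integrable_mul_of_hasCompactSupport hψ hψc), hU.2 φ hφ hφc, hV.2 φ hφ hφc]
      have h1 : Integrable (fun x => h x * φ x) :=
        hloch.integrable_mul_of_hasCompactSupport hφ.continuous hφc
      have h2 : ∫ x, (ball (0 : EuclideanSpace ℝ (Fin D)) n).indicator h x * φ x ≤ ∫ x,
        h x * φ x := by
        refine integral_mono_of_nonneg ?_ h1 ?_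
        · filter_upwards [hnonneg] with y hy
          exact mul_nonneg (indicator_apply_nonneg fun _ => hy) (hφ0 y)
        · filter_upwards [hnonneg] with y hy
          exact mul_le_mul_of_nonneg_right (indicator_le_self' (fun _ _ => hy) y) (hφ0 y)
      linarith
    · intro ε hε
      obtain ⟨S, hS⟩ := hK.potential_indicator_decay hM hε
      refine ⟨S, ?_⟩
      filter_upwards [hc] with x hx hxS
      linarith [hS x hxS]
  filter_upwards [ae_all_iff.2 hn] with x hx
  rw [potential_eq_iSup]
  exact iSup_le hx

end IsGreenKernel

end Weak

section Newton

variable {D : ℕ}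

lemma locallyIntegrable_norm_rpow_two_sub (hD : 3 ≤ D) :
    LocallyIntegrable (fun x : EuclideanSpace ℝ (Fin D) => ‖x‖ ^ (2 - (D : ℝ))) volume := by
  have : Nonempty (Fin D) := ⟨⟨0, by omega⟩⟩
  intro x
  refine ⟨ball 0 (‖x‖ + 1), isOpen_ball.mem_nhds (by simp), ?_⟩
  refine (integrableOn_fun_norm_addHaar volume
    (f := fun t => t ^ (2 - (D : ℝ)))).2 ?_
  have h1 : IntegrableOn (fun y : ℝ => y) (Ioo 0 (‖x‖ + 1)) :=
    (continuous_id.integrableOn_Icc).mono_set Ioo_subset_Icc_self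
  refine h1.congr_fun (fun y hy => ?_) measurableSet_Ioo
  have hy0 : 0 < y := hy.1
  simp only [finrank_euclideanSpace, Fintype.card_fin, smul_eq_mul]
  rw [← Real.rpow_natCast, ← Real.rpow_add hy0, Nat.cast_sub (by omega)]
  norm_num

lemma exists_norm_rpow_two_sub_le (hD : 3 ≤ D) {ε : ℝ} (hε : 0 < ε) :
    ∃ S : ℝ, ∀ x : EuclideanSpace ℝ (Fin D), S ≤ ‖x‖ → ‖x‖ ^ (2 - (D : ℝ)) ≤ ε := by
  have hD' : (3 : ℝ) ≤ D := by exact_mod_cast hD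
  have h1 := tendsto_rpow_neg_atTop (y := (D : ℝ) - 2) (by linarith)
  simp only [neg_sub] at h1
  obtain ⟨S, hS⟩ := eventually_atTop.1 (h1.eventually_le_const hε)
  exact ⟨S, fun x hx => hS _ hx⟩

/-- The normalizing constant of the fundamental solution is positive. -/
lemma fundamental_constant_pos (hD : 3 ≤ D) {cD : ℝ}
    (hcD : ∀ φ : EuclideanSpace ℝ (Fin D) → ℝ, ContDiff ℝ ∞ φ → HasCompactSupport φ →
      ∫ x : EuclideanSpace ℝ (Fin D), cD * ‖x‖ ^
        (2 - (D : ℝ)) * laplacian φ x = -φ 0) : 0 < cD := by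
  have : Nonempty (Fin D) := ⟨⟨0, by omega⟩⟩
  have hne : cD ≠ 0 := by
    rintro rfl
    let f : ContDiffBump (0 : EuclideanSpace ℝ (Fin D)) := ⟨1, 2, one_pos, one_lt_two⟩
    have h1 := hcD f f.contDiff f.hasCompactSupport
    have h2 : f 0 = 1 := f.one_of_mem_closedBall (by simp [f.rIn_pos.le])
    simp [h2] at h1
  have hae := ae_le_of_integral_mul_laplacian_nonpos (c := 0) (by omega : 0 < D)
    (W := fun x : EuclideanSpace ℝ (Fin D) => cD * ‖x‖ ^ (2 - (D : ℝ)))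
    ((locallyIntegrable_norm_rpow_two_sub hD).smul cD)
    (fun φ hφ hc h0 => by rw [hcD φ hφ hc]; linarith [h0 0])
    (fun ε hε => by
      obtain ⟨S, hS⟩ := exists_norm_rpow_two_sub_le hD (div_pos hε (abs_pos.2 hne))
      refine ⟨S, Eventually.of_forall fun x hx => ?_⟩
      have h1 := (le_div_iff₀ (abs_pos.2 hne)).1 (hS x hx)
      have h2 : 0 ≤ ‖x‖ ^ (2 - (D : ℝ)) := by positivity
      nlinarith [neg_abs_le cD])
  obtain ⟨x, hx, hx0⟩ := (hae.and (Measure.ae_ne volume 0)).exists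
  have h3 : 0 < ‖x‖ ^ (2 - (D : ℝ)) := Real.rpow_pos_of_pos (norm_pos_iff.2 hx0) _
  exact lt_of_le_of_ne (nonneg_of_mul_nonneg_left hx h3) hne.symm

lemma isGreenKernel_newton (hD : 3 ≤ D) {cD : ℝ}
    (hcD : ∀ φ : EuclideanSpace ℝ (Fin D) → ℝ, ContDiff ℝ ∞ φ → HasCompactSupport φ →
      ∫ x : EuclideanSpace ℝ (Fin D), cD * ‖x‖ ^ (2 - (D : ℝ)) * laplacian φ x = -φ 0) :
    IsGreenKernel fun x : EuclideanSpace ℝ (Fin D) => cD * ‖x‖ ^ (2 - (D : ℝ)) := by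
  have hpos := fundamental_constant_pos hD hcD
  refine ⟨by fun_prop, fun x => by positivity, fun x => by simp, fun x hx => ?_,
    (locallyIntegrable_norm_rpow_two_sub hD).smul cD, fun ε hε => ?_, hcD⟩
  · exact continuousAt_const.mul
      (continuous_norm.continuousAt.rpow_const (Or.inl (norm_ne_zero_iff.2 hx)))
  · obtain ⟨S, hS⟩ := exists_norm_rpow_two_sub_le hD (div_pos hε hpos)
    refine ⟨S, fun x hx => ?_⟩
    have := (le_div_iff₀ hpos).1 (hS x hx)
    linarith

end Newton

/-- (Brezis–Kamin.) For `h ∈ L^∞_loc`, `h ≥ 0` a.e., there is a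
bounded solution of `−ΔU = h` iff the Newtonian potential
`u⋆ = c_D |·|^{2-D} ⋆ h` is in `L^∞`; in that case `u⋆` is the minimal positive
solution. -/
theorem stmt18 (D : ℕ) (hD : 3 ≤ D)
    (cD : ℝ)
    -- `c_D |x|^{2-D}` is the fundamental solution of the Laplacian:
    (hcD : ∀ φ : EuclideanSpace ℝ (Fin D) → ℝ, ContDiff ℝ (⊤ : ℕ∞) φ → HasCompactSupport φ →
      ∫ x : EuclideanSpace ℝ (Fin D), cD * ‖x‖ ^ (2 - (D:ℝ)) * laplacian φ x = -φ 0)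
    (h : EuclideanSpace ℝ (Fin D) → ℝ)
    (hmeas : AEStronglyMeasurable h volume)
    (hloc : ∀ r : ℝ, 0 < r →
      ∃ C : ℝ, ∀ᵐ x ∂volume, x ∈ ball (0 : EuclideanSpace ℝ (Fin D)) r → |h x| ≤ C)
    (hnonneg : ∀ᵐ x ∂volume, 0 ≤ h x)
    (ustar : EuclideanSpace ℝ (Fin D) → ℝ)
    (hustar : ∀ x, ustar x =
      cD * (∫⁻ y, ENNReal.ofReal (‖x - y‖ ^ (2 - (D:ℝ)) * h y)).toReal) :
    ((∃ U : EuclideanSpace ℝ (Fin D) → ℝ,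
        (∃ C : ℝ, ∀ x, |U x| ≤ C) ∧ IsDistribSol h U) ↔
      (∃ C : ℝ, ∀ x : EuclideanSpace ℝ (Fin D),
        (∫⁻ y, ENNReal.ofReal (cD * ‖x - y‖ ^ (2 - (D:ℝ)) * h y)) ≤ ENNReal.ofReal C)) ∧
    ((∃ C : ℝ, ∀ x : EuclideanSpace ℝ (Fin D),
        (∫⁻ y, ENNReal.ofReal (cD * ‖x - y‖ ^ (2 - (D:ℝ)) * h y)) ≤ ENNReal.ofReal C) →
      IsDistribSol h ustar ∧
        ∀ U : EuclideanSpace ℝ (Fin D) → ℝ, IsDistribSol h U →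
          (∀ᵐ x ∂volume, 0 < U x) → ∀ᵐ x ∂volume, ustar x ≤ U x) := by
  have hK := isGreenKernel_newton hD hcD
  have hpos := fundamental_constant_pos hD hcD
  have hD0 : 0 < D := by omega
  have hust : ustar = fun x =>
      (potential (fun x => cD * ‖x‖ ^ (2 - (D : ℝ))) h x).toReal := by
    ext x
    rw [hustar, potential]
    simp only [mul_assoc, ENNReal.ofReal_mul hpos.le]
    rw [lintegral_const_mul' _ _ ENNReal.ofReal_ne_top, ENNReal.toReal_mul,
      ENNReal.toReal_ofReal hpos.le]
  refine ⟨⟨?_, ?_⟩, ?_⟩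
  · rintro ⟨U, ⟨C, hC⟩, hU⟩
    refine ⟨C - -C, hK.potential_le_of_ae_le hD0 hmeas ?_⟩
    filter_upwards [hK.potential_le_of_isDistribSol hD0 hmeas hloc hnonneg hU
      (Eventually.of_forall fun x => (abs_le.1 (hC x)).1)] with x hx
    exact hx.trans (ENNReal.ofReal_le_ofReal (sub_le_sub_right (abs_le.1 (hC x)).2 _))
  · rintro ⟨C, hC⟩
    refine ⟨_, ⟨max C 0, fun x => ?_⟩, hK.isDistribSol_potential hmeas hnonneg hC⟩
    rw [abs_of_nonneg ENNReal.toReal_nonneg, ← ENNReal.toReal_ofReal']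
    exact ENNReal.toReal_mono ENNReal.ofReal_ne_top (hC x)
  · rintro ⟨C, hC⟩
    rw [hust]
    refine ⟨hK.isDistribSol_potential hmeas hnonneg hC, fun U hU hU0 => ?_⟩
    filter_upwards [hU0, hK.potential_le_of_isDistribSol hD0 hmeas hloc hnonneg hU
      (hU0.mono fun x hx => hx.le)] with x hx hle
    rw [sub_zero] at hle
    exact ENNReal.toReal_le_of_le_ofReal hx.le hle
end
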